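/- arXiv:2106.06643 — 2 statements merged into one kernel-verified Lean document; each statement's English description precedes it below -/
import Mathlib

section
/- Let K be an algebraically closed field and let d ≥ 2. Let X = {F = 0} ⊂ ℙ³_K be a surface of degree d whose singular locus Sing(X) is a finite set, and suppose that X has a point of multiplicity d−1. Then |Sing(X)| ≤ 1 + d(d−1)/2. -/
open MvPolynomial

noncomputable section

/-- The singular locus of the surface `{F = 0} ⊆ ℙ³_K`: the set of points of `ℙ³_K` at which
`F` and all four partial derivatives of `F` vanish (tested on every representative vector). -/
def singLocus {K : Type*} [Field K] (F : MvPolynomial (Fin 4) K) :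
    Set (Projectivization K (Fin 4 → K)) :=
  {p | ∀ (v : Fin 4 → K) (hv : v ≠ 0), Projectivization.mk K v hv = p →
      (eval v F = 0 ∧ ∀ i, eval v (pderiv i F) = 0)}

/-- The homomorphism `f(x) ↦ f(tx)`. -/
def gradHom (σ K : Type*) [Field K] : MvPolynomial σ K →ₐ[K] Polynomial (MvPolynomial σ K) :=
  aeval (fun i => Polynomial.C (X i) * Polynomial.X)

lemma gradHom_monomial {σ K : Type*} [Field K] (s : σ →₀ ℕ) (a : K) :
    gradHom σ K (monomial s a) = Polynomial.monomial s.degree (monomial s a) := by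
  rw [gradHom, aeval_monomial, ← Polynomial.C_mul_X_pow_eq_monomial]
  rw [MvPolynomial.monomial_eq (s := s)]
  simp only [Finsupp.prod, mul_pow, Finset.prod_mul_distrib, Finset.prod_pow_eq_pow_sum,
    Finsupp.degree_apply, map_mul, map_prod, map_pow, mul_assoc]
  congr 1

lemma gradHom_coeff {σ K : Type*} [Field K] (f : MvPolynomial σ K) (k : ℕ) :
    (gradHom σ K f).coeff k = homogeneousComponent k f := by
  induction f using MvPolynomial.induction_on' with
  | monomial s a =>
    rw [gradHom_monomial, homogeneousComponent_of_mem
      (n := s.degree) ((mem_homogeneousSubmodule _ _).2 (isHomogeneous_monomial a rfl)), Polynomial.coeff_monomial]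
    simp [eq_comm]
  | add p q hp hq => simp [hp, hq]

lemma gradHom_eq_monomial {σ K : Type*} [Field K] {f : MvPolynomial σ K} {n : ℕ}
    (hf : f.IsHomogeneous n) : gradHom σ K f = Polynomial.monomial n f := by
  ext1 k
  rw [gradHom_coeff, homogeneousComponent_of_mem ((mem_homogeneousSubmodule _ _).2 hf),
    Polynomial.coeff_monomial]
  simp [eq_comm]

lemma gradHom_ne_zero {σ K : Type*} [Field K] {f : MvPolynomial σ K} (hf : f ≠ 0) :
    gradHom σ K f ≠ 0 := by
  intro h
  apply hf
  rw [← sum_homogeneousComponent f]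
  exact Finset.sum_eq_zero fun k _ => by rw [← gradHom_coeff, h, Polynomial.coeff_zero]

lemma isHomogeneous_of_gradHom {σ K : Type*} [Field K] {f : MvPolynomial σ K}
    (h : (gradHom σ K f).natDegree = (gradHom σ K f).natTrailingDegree) :
    f.IsHomogeneous (gradHom σ K f).natDegree := by
  have : f = homogeneousComponent (gradHom σ K f).natDegree f := by
    conv_lhs => rw [← sum_homogeneousComponent f]
    rw [Finset.sum_eq_single (gradHom σ K f).natDegree]
    · intro b _ hb
      rw [← gradHom_coeff]
      rcases lt_or_gt_of_ne hb with hb | hb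
      · exact Polynomial.coeff_eq_zero_of_lt_natTrailingDegree (h ▸ hb)
      · exact Polynomial.coeff_eq_zero_of_natDegree_lt hb
    · intro hb
      apply homogeneousComponent_eq_zero
      simpa using hb
  rw [this]
  conv => arg 2; rw [← this]
  exact homogeneousComponent_isHomogeneous _ _

/-- Factors of a homogeneous polynomial are homogeneous. -/
lemma isHomogeneous_factors {σ K : Type*} [Field K] {f g : MvPolynomial σ K} {n : ℕ}
    (hfg : (f * g).IsHomogeneous n) (h0 : f * g ≠ 0) :
    ∃ a b, a + b = n ∧ f.IsHomogeneous a ∧ g.IsHomogeneous b := by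
  have hf := left_ne_zero_of_mul h0
  have hg := right_ne_zero_of_mul h0
  have e := gradHom_eq_monomial hfg
  rw [map_mul] at e
  have e1 := congrArg Polynomial.natDegree e
  have e2 := congrArg Polynomial.natTrailingDegree e
  rw [Polynomial.natDegree_mul (gradHom_ne_zero hf) (gradHom_ne_zero hg),
    Polynomial.natDegree_monomial_eq _ h0] at e1
  rw [Polynomial.natTrailingDegree_mul (gradHom_ne_zero hf) (gradHom_ne_zero hg),
    Polynomial.natTrailingDegree_monomial h0] at e2
  have i1 := Polynomial.natTrailingDegree_le_natDegree (gradHom σ K f)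
  have i2 := Polynomial.natTrailingDegree_le_natDegree (gradHom σ K g)
  exact ⟨_, _, e1, isHomogeneous_of_gradHom (by omega), isHomogeneous_of_gradHom (by omega)⟩

lemma degree_set_eq (n : ℕ) : {d : Fin 3 →₀ ℕ | d.degree = n} =
    ((Finset.finsuppAntidiag (Finset.univ : Finset (Fin 3)) n : Finset _) : Set (Fin 3 →₀ ℕ)) := by
  ext d
  simp [Finset.mem_finsuppAntidiag, Finsupp.degree_eq_sum]

/-- Linear equivalence of the homogeneous part with finitely supported functions. -/
lemma homog_equiv (K : Type*) [Field K] (n : ℕ) :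
    Nonempty (homogeneousSubmodule (Fin 3) K n ≃ₗ[K]
      ((Finset.finsuppAntidiag (Finset.univ : Finset (Fin 3)) n : Finset _) →₀ K)) := by
  have h : homogeneousSubmodule (Fin 3) K n = restrictSupport K
    ((Finset.finsuppAntidiag (Finset.univ : Finset (Fin 3)) n : Finset _) : Set (Fin 3 →₀ ℕ)) := by
    rw [homogeneousSubmodule_eq_finsupp_supported, degree_set_eq]; rfl
  rw [h]
  exact ⟨(basisRestrictSupport K _).repr⟩

instance homog_finite (K : Type*) [Field K] (n : ℕ) :
    FiniteDimensional K (homogeneousSubmodule (Fin 3) K n) := by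
  obtain ⟨e⟩ := homog_equiv K n
  exact Module.Finite.equiv e.symm

lemma homog_finrank (K : Type*) [Field K] (n : ℕ) :
    Module.finrank K (homogeneousSubmodule (Fin 3) K n) = (n + 2).choose 2 := by
  obtain ⟨e⟩ := homog_equiv K n
  rw [e.finrank_eq, Module.finrank_finsupp_self, Fintype.card_coe,
    Finset.card_finsuppAntidiag_nat_eq_choose]
  simp only [Finset.card_univ, Fintype.card_fin]
  rw [show 3 + n - 1 = n + 2 by omega, ← Nat.choose_symm_add]

/-- Multiplication by a form between homogeneous parts. -/
def mulForm {K : Type*} [Field K] (G : MvPolynomial (Fin 3) K) {m k N : ℕ}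
    (hG : G.IsHomogeneous m) (h : k + m = N) :
    homogeneousSubmodule (Fin 3) K k →ₗ[K] homogeneousSubmodule (Fin 3) K N :=
  (LinearMap.mulRight K G).restrict (fun f hf => by
    rw [mem_homogeneousSubmodule] at *
    subst h
    simpa using hf.mul hG)

@[simp] lemma mulForm_coe {K : Type*} [Field K] (G : MvPolynomial (Fin 3) K) {m k N : ℕ}
    (hG : G.IsHomogeneous m) (h : k + m = N) (f : homogeneousSubmodule (Fin 3) K k) :
    (mulForm G hG h f : MvPolynomial (Fin 3) K) = f * G := rfl

lemma choose_identity (m n j : ℕ) : (m + n + j + 2).choose 2 + (j + 2).choose 2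
    = (n + j + 2).choose 2 + (m + j + 2).choose 2 + m * n := by
  have : (((m + n + j + 2).choose 2 + (j + 2).choose 2 : ℕ) : ℚ)
    = (((n + j + 2).choose 2 + (m + j + 2).choose 2 + m * n : ℕ) : ℚ) := by
    push_cast [Nat.cast_choose_two]
    ring
  exact_mod_cast this

lemma koszul_bound {K : Type*} [Field K] {G B : MvPolynomial (Fin 3) K} {m n : ℕ} (j : ℕ)
    (hG : G.IsHomogeneous m) (hB : B.IsHomogeneous n) (hG0 : G ≠ 0) (hrel : IsRelPrime G B) :
    ∃ W : Submodule K (homogeneousSubmodule (Fin 3) K (m + n + j)),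
      (∀ f ∈ W, ∃ a b, (f : MvPolynomial (Fin 3) K) = a * G + b * B) ∧
      Module.finrank K (homogeneousSubmodule (Fin 3) K (m + n + j)) ≤
        Module.finrank K W + m * n := by
  let φ := (mulForm G hG (show n + j + m = m + n + j by omega)).coprod
    (mulForm B hB (show m + j + n = m + n + j by omega))
  let χ := (mulForm (-B) hB.neg (show j + n = n + j by omega)).prod
    (mulForm G hG (show j + m = m + j by omega))
  have hker : LinearMap.ker φ ≤ LinearMap.range χ := by
    rintro ⟨⟨a, ha⟩, ⟨b, hb⟩⟩ hab
    have hab' : a * G + b * B = 0 := by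
      have := congrArg Subtype.val (LinearMap.mem_ker.1 hab)
      simpa [φ] using this
    have hd : G ∣ b := by
      apply hrel.dvd_of_dvd_mul_left
      exact ⟨-a, by linear_combination hab'⟩
    obtain ⟨c, rfl⟩ := hd
    have hac : a = -(c * B) := by
      apply mul_right_cancel₀ hG0
      linear_combination hab'
    have hc : ∃ c' : homogeneousSubmodule (Fin 3) K j, (c' : MvPolynomial (Fin 3) K) = c := by
      rcases eq_or_ne c 0 with rfl | hc0
      · exact ⟨0, rfl⟩
      · rw [mem_homogeneousSubmodule] at hb
        obtain ⟨p, q, hpq, hp, hq⟩ := isHomogeneous_factors hb (mul_ne_zero hG0 hc0)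
        have : p = m := hp.inj_right hG hG0
        have : q = j := by omega
        subst this
        exact ⟨⟨c, hq⟩, rfl⟩
    obtain ⟨c', hc'⟩ := hc
    refine ⟨c', ?_⟩
    apply Prod.ext
    · apply Subtype.ext
      simp [χ, hc', hac]
    · apply Subtype.ext
      simp [χ, hc', mul_comm]
  refine ⟨LinearMap.range φ, ?_, ?_⟩
  · rintro _ ⟨⟨a, b⟩, rfl⟩
    exact ⟨a, b, by simp [φ]⟩
  · have h1 := LinearMap.finrank_range_add_finrank_ker φ
    have h2 := Submodule.finrank_mono hker
    have h3 := LinearMap.finrank_range_le χ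
    rw [Module.finrank_prod] at h1
    simp only [homog_finrank] at *
    have := choose_identity m n j
    omega

/-- Directional derivative of `f` at `x` in the direction `t`. -/
def dirD {K : Type*} [Field K] (x t : Fin 3 → K) : MvPolynomial (Fin 3) K →ₗ[K] K :=
  ∑ k, t k • ((aeval x).toLinearMap ∘ₗ (pderiv k).toLinearMap)

lemma dirD_apply {K : Type*} [Field K] (x t : Fin 3 → K) (f : MvPolynomial (Fin 3) K) :
    dirD x t f = ∑ k, t k * eval x (pderiv k f) := by
  simp [dirD, aeval_eq_eval]

lemma dirD_mul {K : Type*} [Field K] (x t : Fin 3 → K) (f g : MvPolynomial (Fin 3) K) :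
    dirD x t (f * g) = dirD x t f * eval x g + eval x f * dirD x t g := by
  simp only [dirD_apply, pderiv_mul, map_add, map_mul, Finset.mul_sum, Finset.sum_mul,
    ← Finset.sum_add_distrib]
  exact Finset.sum_congr rfl fun k _ => by ring

/-- The linear form attached to a functional. -/
def linForm {K ι : Type*} [Field K] [Fintype ι] [DecidableEq ι] (L : (ι → K) →ₗ[K] K) : MvPolynomial ι K :=
  ∑ k, C (L (Pi.single k 1)) * X k

lemma linForm_hom {K ι : Type*} [Field K] [Fintype ι] [DecidableEq ι] (L : (ι → K) →ₗ[K] K) :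
    (linForm L).IsHomogeneous 1 :=
  IsHomogeneous.sum _ _ _ fun k _ => isHomogeneous_C_mul_X _ _

lemma linForm_eval {K ι : Type*} [Field K] [Fintype ι] [DecidableEq ι] (L : (ι → K) →ₗ[K] K) (x : ι → K) :
    eval x (linForm L) = L x := by
  conv_rhs => rw [LinearMap.pi_apply_eq_sum_univ L x]
  simp only [linForm, map_sum, map_mul, eval_C, eval_X, smul_eq_mul]
  refine Finset.sum_congr rfl fun k _ => ?_
  rw [mul_comm]; congr 2; ext i; simp [Pi.single_apply, eq_comm]

lemma linForm_dirD {K : Type*} [Field K] (L : (Fin 3 → K) →ₗ[K] K) (x t : Fin 3 → K) :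
    dirD x t (linForm L) = L t := by
  rw [← linForm_eval L t, dirD_apply]
  simp only [linForm, map_sum, map_mul, eval_C, eval_X, pderiv_C_mul, pderiv_X, Pi.single_apply]
  simp [mul_comm]

/-- A functional with prescribed values on two independent vectors. -/
lemma exists_functional {K V : Type*} [Field K] [AddCommGroup V] [Module K V] {x t : V}
    (h : LinearIndependent K ![x, t]) (α β : K) : ∃ L : V →ₗ[K] K, L x = α ∧ L t = β := by
  obtain ⟨L, hL⟩ := LinearMap.exists_extend ((Module.Basis.span h).constr K ![α, β])
  refine ⟨L, ?_, ?_⟩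
  · have := LinearMap.congr_fun hL (Module.Basis.span h 0)
    rw [Module.Basis.constr_basis] at this
    simpa [Module.Basis.span_apply] using this
  · have := LinearMap.congr_fun hL (Module.Basis.span h 1)
    rw [Module.Basis.constr_basis] at this
    simpa [Module.Basis.span_apply] using this

lemma exists_direction {K : Type*} [Field K] {x : Fin 3 → K} (hx : x ≠ 0) (L : (Fin 3 → K) →ₗ[K] K) :
    ∃ t, LinearIndependent K ![x, t] ∧ L t = 0 := by
  have h1 := LinearMap.finrank_range_add_finrank_ker L
  have h2 : Module.finrank K (LinearMap.range L) ≤ 1 := by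
    simpa using Submodule.finrank_le (LinearMap.range L)
  rw [Module.finrank_fin_fun] at h1
  have h3 : ¬ LinearMap.ker L ≤ Submodule.span K {x} := by
    intro h
    have := Submodule.finrank_mono h
    rw [finrank_span_singleton hx] at this
    omega
  obtain ⟨t, ht, hxt⟩ := Set.not_subset.1 h3
  refine ⟨t, ?_, ht⟩
  rw [LinearIndependent.pair_iff' hx]
  intro a ha
  exact hxt (Submodule.mem_span_singleton.2 ⟨a, ha⟩)

/-- Interpolation of 1-jets. -/
lemma interp {K ι : Type*} [Field K] [Fintype ι] [DecidableEq ι] (x t : ι → Fin 3 → K)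
    (hx : ∀ i j, i ≠ j → LinearIndependent K ![x i, x j])
    (ht : ∀ i, LinearIndependent K ![x i, t i]) (N : ℕ) (hN : 2 * Fintype.card ι ≤ N) (i : ι)
    (α β : K) : ∃ f : MvPolynomial (Fin 3) K, f.IsHomogeneous (N + 1) ∧
      eval (x i) f = α ∧ dirD (x i) (t i) f = β ∧
      ∀ j, j ≠ i → eval (x j) f = 0 ∧ dirD (x j) (t j) f = 0 := by
  have hL : ∀ j, ∃ L : (Fin 3 → K) →ₗ[K] K, L (x i) = 1 ∧ (j ≠ i → L (x j) = 0) := by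
    intro j
    by_cases h : j = i
    · obtain ⟨L, h1, -⟩ := exists_functional (ht i) 1 0
      exact ⟨L, h1, fun h' => absurd h h'⟩
    · obtain ⟨L, h1, h2⟩ := exists_functional (hx i j (Ne.symm h)) 1 0
      exact ⟨L, h1, fun _ => h2⟩
  choose L hL1 hL2 using hL
  let E : MvPolynomial (Fin 3) K := (∏ j, linForm (L j) ^ 2) * linForm (L i) ^ (N - 2 * Fintype.card ι)
  have hE : E.IsHomogeneous N := by
    have h1 : (∏ j, linForm (L j) ^ 2).IsHomogeneous (∑ j : ι, 1 * 2) :=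
      IsHomogeneous.prod _ _ _ fun j _ => (linForm_hom (L j)).pow 2
    have h2 := h1.mul ((linForm_hom (L i)).pow (N - 2 * Fintype.card ι))
    convert h2 using 1
    simp
    omega
  have hEi : eval (x i) E = 1 := by
    simp [E, linForm_eval, hL1]
  obtain ⟨M, hM1, hM2⟩ := exists_functional (ht i) α (β - dirD (x i) (t i) E * α)
  refine ⟨E * linForm M, hE.mul (linForm_hom M), ?_, ?_, ?_⟩
  · rw [map_mul, hEi, linForm_eval, hM1, one_mul]
  · rw [dirD_mul, hEi, linForm_eval, linForm_dirD, hM1, hM2]; ring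
  · intro j hj
    have : ∃ Q, E * linForm M = linForm (L j) * (linForm (L j) * Q) := by
      have : E = linForm (L j) * (linForm (L j) * ((∏ k ∈ Finset.univ.erase j, linForm (L k) ^ 2)
          * linForm (L i) ^ (N - 2 * Fintype.card ι))) := by
        simp only [E]
        rw [← Finset.mul_prod_erase _ _ (Finset.mem_univ j)]
        ring
      rw [this]
      exact ⟨_, by rw [mul_assoc, mul_assoc]⟩
    obtain ⟨Q, hQ⟩ := this
    rw [hQ]
    simp [dirD_mul, linForm_eval, hL2 j hj]

/-- Bezout bound for tangential intersections. -/
lemma bezout_tangent {K ι : Type*} [Field K] [Fintype ι] {G B : MvPolynomial (Fin 3) K} {m n : ℕ}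
    (hG : G.IsHomogeneous m) (hB : B.IsHomogeneous n) (hG0 : G ≠ 0) (hrel : IsRelPrime G B)
    (x : ι → Fin 3 → K) (hx0 : ∀ i, x i ≠ 0)
    (hx : ∀ i j, i ≠ j → LinearIndependent K ![x i, x j])
    (hGx : ∀ i, eval (x i) G = 0) (hBx : ∀ i, eval (x i) B = 0)
    (z : ι → K) (hz : ∀ i k, z i * eval (x i) (pderiv k G) + eval (x i) (pderiv k B) = 0) :
    2 * Fintype.card ι ≤ m * n := by
  classical
  have hdir : ∀ i, ∃ t, LinearIndependent K ![x i, t] ∧ dirD (x i) t G = 0 := by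
    intro i
    obtain ⟨t, h1, h2⟩ := exists_direction (hx0 i)
      (∑ k, eval (x i) (pderiv k G) • (LinearMap.proj k : (Fin 3 → K) →ₗ[K] K))
    refine ⟨t, h1, ?_⟩
    rw [dirD_apply, ← h2]
    simp [mul_comm]
  choose t ht htG using hdir
  have htB : ∀ i, dirD (x i) (t i) B = 0 := by
    intro i
    have : dirD (x i) (t i) B = - z i * dirD (x i) (t i) G := by
      rw [dirD_apply, dirD_apply, Finset.mul_sum]
      refine Finset.sum_congr rfl fun k _ => ?_
      linear_combination (t i k) * hz i k
    rw [this, htG, mul_zero]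
  obtain ⟨W, hW, hWr⟩ := koszul_bound (2 * Fintype.card ι + 1) hG hB hG0 hrel
  let ψ : homogeneousSubmodule (Fin 3) K (m + n + (2 * Fintype.card ι + 1)) →ₗ[K] (ι → K × K) :=
    (LinearMap.pi fun i => ((aeval (x i)).toLinearMap).prod (dirD (x i) (t i))) ∘ₗ
      Submodule.subtype _
  have hψ : ∀ f i, ψ f i = (eval (x i) f.1, dirD (x i) (t i) f.1) := fun f i => by
    simp [ψ, aeval_eq_eval]
  have hsurj : Function.Surjective ψ := by
    intro y
    choose f hf h1 h2 h3 using fun i => interp x t hx ht (m + n + 2 * Fintype.card ι) (by omega) i (y i).1 (y i).2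
    refine ⟨∑ i, ⟨f i, hf i⟩, ?_⟩
    funext j
    rw [map_sum, Finset.sum_apply, Finset.sum_eq_single j]
    · rw [hψ, h1, h2]
    · intro i _ hij
      rw [hψ, (h3 i j hij.symm).1, (h3 i j hij.symm).2]; rfl
    · simp
  have hWk : W ≤ LinearMap.ker ψ := by
    intro f hf
    obtain ⟨a, b, hab⟩ := hW f hf
    rw [LinearMap.mem_ker]
    funext i
    rw [hψ, hab]
    simp [dirD_mul, hGx, hBx, htG, htB]
  have h1 := LinearMap.finrank_range_add_finrank_ker ψ
  rw [LinearMap.range_eq_top.2 hsurj, finrank_top] at h1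
  have h2 := Submodule.finrank_mono hWk
  have h3 : Module.finrank K (ι → K × K) = 2 * Fintype.card ι := by
    rw [Module.finrank_pi_fintype]; simp [mul_comm]
  omega

/-- Height of a maximal ideal of a point. -/
lemma height_point {K : Type*} [Field K] [IsAlgClosed K] (a : Fin 4 → K) :
    (vanishingIdeal K ({a} : Set (Fin 4 → K))).height = 4 := by
  have hdim : ringKrullDim (MvPolynomial (Fin 4) K) = 4 := by
    rw [MvPolynomial.ringKrullDim_of_isNoetherianRing]
    simp
  have : FiniteRingKrullDim (MvPolynomial (Fin 4) K) := by
    rw [finiteRingKrullDim_iff_ne_bot_and_top, hdim]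
    exact ⟨by decide, by decide⟩
  obtain ⟨p, hp, hh⟩ := Ideal.exists_isMaximal_height (R := MvPolynomial (Fin 4) K)
  obtain ⟨b, rfl⟩ := isMaximal_iff_eq_vanishingIdeal_singleton.1 hp
  let f (c : Fin 4 → K) : MvPolynomial (Fin 4) K →ₐ[K] MvPolynomial (Fin 4) K :=
    aeval (fun i => X i + C (c i))
  have hf : ∀ c, (f c).comp (f (-c)) = AlgHom.id K _ := by
    intro c
    ext1 i
    simp [f]
  let e : MvPolynomial (Fin 4) K ≃ₐ[K] MvPolynomial (Fin 4) K :=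
    AlgEquiv.ofAlgHom (f (b - a)) (f (-(b - a))) (hf _) (by simpa using hf (-(b - a)))
  have hcomap : Ideal.comap e.toRingEquiv (vanishingIdeal K ({a} : Set (Fin 4 → K))) =
      vanishingIdeal K ({b} : Set (Fin 4 → K)) := by
    ext g
    rw [Ideal.mem_comap, mem_vanishingIdeal_singleton_iff, mem_vanishingIdeal_singleton_iff]
    have : (aeval a).comp (f (b - a)) = (aeval b : MvPolynomial (Fin 4) K →ₐ[K] K) := by
      ext1 i
      simp [f]
    rw [← this]
    rfl
  have h2 := RingEquiv.height_comap e.toRingEquiv (vanishingIdeal K ({a} : Set (Fin 4 → K)))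
  rw [hcomap] at h2
  rw [← h2]
  rw [hdim] at hh
  exact WithBot.coe_injective hh

lemma exists_common_zero {K : Type*} [Field K] [IsAlgClosed K] (f₁ f₂ f₃ : MvPolynomial (Fin 4) K)
    (h₁ : eval 0 f₁ = 0) (h₂ : eval 0 f₂ = 0) (h₃ : eval 0 f₃ = 0) :
    ∃ v : Fin 4 → K, v ≠ 0 ∧ eval v f₁ = 0 ∧ eval v f₂ = 0 ∧ eval v f₃ = 0 := by
  classical
  by_contra hcon
  push Not at hcon
  let s : Finset (MvPolynomial (Fin 4) K) := {f₁, f₂, f₃}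
  have hz : zeroLocus K (Ideal.span (s : Set (MvPolynomial (Fin 4) K))) = {0} := by
    rw [zeroLocus_span]
    ext v
    simp only [s, Finset.coe_insert, Finset.coe_singleton, Set.mem_insert_iff,
      Set.mem_singleton_iff, Set.mem_ofPred_eq, forall_eq_or_imp, forall_eq, aeval_eq_eval]
    constructor
    · rintro ⟨a, b, c⟩
      by_contra hv
      exact hcon v hv a b c
    · rintro rfl
      exact ⟨h₁, h₂, h₃⟩
  have hrad := vanishingIdeal_zeroLocus_eq_radical (k := K) (K := K)
    (Ideal.span (s : Set (MvPolynomial (Fin 4) K)))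
  rw [hz] at hrad
  have hmax : (vanishingIdeal K ({0} : Set (Fin 4 → K))).IsMaximal :=
    isMaximal_iff_eq_vanishingIdeal_singleton.2 ⟨0, rfl⟩
  have hmin : vanishingIdeal K ({0} : Set (Fin 4 → K)) ∈
      (Ideal.span (s : Set (MvPolynomial (Fin 4) K))).minimalPrimes := by
    refine ⟨⟨hmax.isPrime, hrad ▸ Ideal.le_radical⟩, ?_⟩
    rintro q ⟨hq, hle⟩ -
    rw [hrad]
    exact hq.radical_le_iff.2 hle
  have := Ideal.height_le_card_of_mem_minimalPrimes_span_finset hmin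
  rw [height_point] at this
  have h3 : s.card ≤ 3 := Finset.card_le_three
  have h4 : (4 : ℕ) ≤ s.card := by exact_mod_cast this
  omega

/-- Singular vectors. -/
def SV {K ι : Type*} [Field K] (F : MvPolynomial ι K) (v : ι → K) : Prop :=
  eval v F = 0 ∧ ∀ i, eval v (pderiv i F) = 0

lemma eval_smul_hom {K ι : Type*} [Field K] {F : MvPolynomial ι K} {d : ℕ}
    (hF : F.IsHomogeneous d) (c : K) (v : ι → K) : eval (c • v) F = c ^ d * eval v F := by
  rw [eval_eq, eval_eq, Finset.mul_sum]
  refine Finset.sum_congr rfl fun s hs => ?_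
  rw [hF.degree_eq_sum_deg_support hs]
  simp only [Pi.smul_apply, smul_eq_mul, mul_pow, Finset.prod_mul_distrib,
    Finset.prod_pow_eq_pow_sum]
  ring

lemma SV.smul {K ι : Type*} [Field K] {F : MvPolynomial ι K} {d : ℕ}
    (hF : F.IsHomogeneous d) (c : K) {v : ι → K} (h : SV F v) : SV F (c • v) := by
  refine ⟨by rw [eval_smul_hom hF, h.1, mul_zero], fun i => ?_⟩
  rw [eval_smul_hom hF.pderiv, h.2, mul_zero]

lemma mk_mem_singLocus {K : Type*} [Field K] {F : MvPolynomial (Fin 4) K} {d : ℕ}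
    (hF : F.IsHomogeneous d) {v : Fin 4 → K} (hv : v ≠ 0) :
    Projectivization.mk K v hv ∈ singLocus F ↔ SV F v := by
  constructor
  · intro h
    exact h v hv rfl
  · intro h w hw hwv
    obtain ⟨a, rfl⟩ := (Projectivization.mk_eq_mk_iff' K w v hw hv).1 hwv
    exact h.smul hF a

lemma pderiv_linear {K : Type*} [Field K] (M : Matrix (Fin 4) (Fin 4) K)
    (F : MvPolynomial (Fin 4) K) (j : Fin 4) :
    pderiv j (bind₁ (fun i => ∑ j, C (M i j) * X j) F) =
      ∑ i, C (M i j) * bind₁ (fun i => ∑ j, C (M i j) * X j) (pderiv i F) := by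
  induction F using MvPolynomial.induction_on with
  | C a => simp
  | add p q hp hq => simp only [map_add, hp, hq, mul_add, Finset.sum_add_distrib]
  | mul_X p k hp =>
    simp only [map_mul, pderiv_mul, hp, bind₁_X_right, map_add, mul_add, Finset.sum_add_distrib]
    congr 1
    · rw [Finset.sum_mul]
      exact Finset.sum_congr rfl fun i _ => by ring
    · simp [pderiv_X, Pi.single_apply, apply_ite, mul_comm]

lemma eval_linear {K : Type*} [Field K] (M : Matrix (Fin 4) (Fin 4) K)
    (F : MvPolynomial (Fin 4) K) (v : Fin 4 → K) :
    eval v (bind₁ (fun i => ∑ j, C (M i j) * X j) F) = eval (M.mulVec v) F := by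
  rw [← aeval_eq_eval, ← aeval_eq_eval, aeval_bind₁]
  congr 2
  funext i
  simp [Matrix.mulVec, dotProduct]

lemma SV_linear {K : Type*} [Field K] (M : Matrix (Fin 4) (Fin 4) K) (hM : IsUnit M.det)
    (F : MvPolynomial (Fin 4) K) (v : Fin 4 → K) :
    SV (bind₁ (fun i => ∑ j, C (M i j) * X j) F) v ↔ SV F (M.mulVec v) := by
  have key : (fun j => eval v (pderiv j (bind₁ (fun i => ∑ j, C (M i j) * X j) F))) =
      M.transpose.mulVec (fun i => eval (M.mulVec v) (pderiv i F)) := by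
    funext j
    rw [pderiv_linear, map_sum]
    change _ = ∑ i, M i j * eval (M.mulVec v) (pderiv i F)
    refine Finset.sum_congr rfl fun i _ => ?_
    rw [map_mul, eval_C, eval_linear]
  have hMT : Function.Injective M.transpose.mulVec := by
    apply Matrix.mulVec_injective_of_isUnit
    rw [Matrix.isUnit_iff_isUnit_det, Matrix.det_transpose]
    exact hM
  unfold SV
  rw [eval_linear]
  refine and_congr_right fun _ => ?_
  constructor
  · intro h i
    have h0 : M.transpose.mulVec (fun i => eval (M.mulVec v) (pderiv i F)) = M.transpose.mulVec 0 := by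
      rw [← key, Matrix.mulVec_zero]; funext j; exact h j
    exact congrFun (hMT h0) i
  · intro h i
    have := congrFun key i
    refine this.trans ?_
    rw [show (fun i => eval (M.mulVec v) (pderiv i F)) = 0 from funext h, Matrix.mulVec_zero]
    rfl

/-- The cone-type form `z G + B`. -/
def zGB {K : Type*} [Field K] (G B : MvPolynomial (Fin 3) K) : MvPolynomial (Fin 4) K :=
  X 3 * rename Fin.castSucc G + rename Fin.castSucc B

lemma zGB_hom {K : Type*} [Field K] {G B : MvPolynomial (Fin 3) K} {m : ℕ}
    (hG : G.IsHomogeneous m) (hB : B.IsHomogeneous (m + 1)) : (zGB G B).IsHomogeneous (m + 1) := by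
  refine IsHomogeneous.add ?_ hB.rename_isHomogeneous
  have h := (isHomogeneous_X K (3 : Fin 4)).mul (hG.rename_isHomogeneous (f := Fin.castSucc))
  rwa [show 1 + m = m + 1 by omega] at h

lemma pderiv_three {K : Type*} [Field K] (G : MvPolynomial (Fin 3) K) :
    pderiv 3 (rename (Fin.castSucc : Fin 3 → Fin 4) G) = 0 := by
  apply pderiv_eq_zero_of_notMem_vars
  intro h
  obtain ⟨k, -, hk⟩ := mem_vars_rename _ _ h
  fin_cases k <;> simp at hk

lemma SV_zGB {K : Type*} [Field K] (G B : MvPolynomial (Fin 3) K) (v : Fin 4 → K) :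
    SV (zGB G B) v ↔ eval (v ∘ Fin.castSucc) G = 0 ∧ eval (v ∘ Fin.castSucc) B = 0 ∧
      ∀ k, v 3 * eval (v ∘ Fin.castSucc) (pderiv k G) + eval (v ∘ Fin.castSucc) (pderiv k B) = 0 := by
  have e0 : eval v (zGB G B) = v 3 * eval (v ∘ Fin.castSucc) G + eval (v ∘ Fin.castSucc) B := by
    simp [zGB, eval_rename]
  have e3 : eval v (pderiv 3 (zGB G B)) = eval (v ∘ Fin.castSucc) G := by
    simp [zGB, eval_rename, pderiv_three]
  have ek : ∀ k : Fin 3, eval v (pderiv k.castSucc (zGB G B)) =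
      v 3 * eval (v ∘ Fin.castSucc) (pderiv k G) + eval (v ∘ Fin.castSucc) (pderiv k B) := by
    intro k
    have h3 : pderiv k.castSucc (X 3 : MvPolynomial (Fin 4) K) = 0 :=
      pderiv_X_of_ne (by fin_cases k <;> simp)
    simp [zGB, eval_rename, pderiv_rename (Fin.castSucc_injective 3), h3]
  constructor
  · rintro ⟨h, h'⟩
    have hG := h' 3
    rw [e3] at hG
    rw [e0, hG, mul_zero, zero_add] at h
    exact ⟨hG, h, fun k => by rw [← ek]; exact h' _⟩
  · rintro ⟨hG, hB, h⟩
    refine ⟨by rw [e0, hG, hB]; simp, fun i => ?_⟩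
    refine Fin.lastCases ?_ (fun k => ?_) i
    · exact e3.trans hG
    · rw [ek, h]

lemma eval_zero_hom {K ι : Type*} [Field K] {f : MvPolynomial ι K} {a : ℕ}
    (hf : f.IsHomogeneous a) (ha : a ≠ 0) : eval 0 f = 0 := by
  have := eval_smul_hom hf 0 0
  rwa [zero_smul, zero_pow ha, zero_mul] at this

lemma isUnit_of_hom_zero {K ι : Type*} [Field K] {f : MvPolynomial ι K}
    (hf : f.IsHomogeneous 0) (h0 : f ≠ 0) : IsUnit f := by
  have h1 := totalDegree_eq_zero_iff_eq_C.1 (hf.totalDegree h0)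
  rw [h1]
  apply IsUnit.map
  rw [isUnit_iff_ne_zero]
  intro h
  rw [h, C_0] at h1
  exact h0 h1

lemma SV_mul {K ι : Type*} [Field K] {f g : MvPolynomial ι K} {v : ι → K}
    (hf : eval v f = 0) (hg : eval v g = 0) : SV (f * g) v :=
  ⟨by simp [hf], fun i => by simp [hf, hg]⟩

lemma relPrime_of_finite {K : Type*} [Field K] [IsAlgClosed K] {G B : MvPolynomial (Fin 3) K}
    {m : ℕ} (hG : G.IsHomogeneous m) (hB : B.IsHomogeneous (m + 1)) (hG0 : G ≠ 0)
    (hfin : (singLocus (zGB G B)).Finite) : IsRelPrime G B := by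
  rintro H ⟨G', rfl⟩ ⟨B', rfl⟩
  by_contra hu
  obtain ⟨a, b, hab, hHa, hGb⟩ := isHomogeneous_factors hG hG0
  have hH0 := left_ne_zero_of_mul hG0
  have ha : a ≠ 0 := by
    rintro rfl
    exact hu (isUnit_of_hom_zero hHa hH0)
  have hB0 : eval 0 B' = 0 := by
    rcases eq_or_ne B' 0 with rfl | hB'
    · simp
    obtain ⟨a', b', hab', hHa', hBb'⟩ := isHomogeneous_factors hB (mul_ne_zero hH0 hB')
    have : a' = a := hHa'.inj_right hHa hH0
    exact eval_zero_hom hBb' (by omega)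
  have hinf : Infinite K := IsAlgClosed.instInfinite
  have := hfin.to_subtype
  obtain ⟨L, hL⟩ := Module.exists_dual_forall_apply_ne_zero (K := K)
    (fun p : singLocus (zGB (H * G') (H * B')) => p.1.rep) (fun p => p.1.rep_nonzero)
  have hfac : zGB (H * G') (H * B') = rename Fin.castSucc H * zGB G' B' := by
    simp only [zGB, map_mul]; ring
  have c0 : ((0 : Fin 4 → K) ∘ (Fin.castSucc : Fin 3 → Fin 4)) = 0 := rfl
  obtain ⟨v, hv, h1, h2, h3⟩ := exists_common_zero (rename Fin.castSucc H) (zGB G' B') (linForm L)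
    (by rw [eval_rename, c0]; exact eval_zero_hom hHa ha)
    (by simpa [zGB] using hB0)
    (eval_zero_hom (linForm_hom L) one_ne_zero)
  have hmem : Projectivization.mk K v hv ∈ singLocus (zGB (H * G') (H * B')) := by
    rw [mk_mem_singLocus (zGB_hom hG hB), hfac]
    exact SV_mul h1 h2
  obtain ⟨c, hc⟩ := Projectivization.exists_smul_eq_mk_rep K v hv
  apply hL ⟨_, hmem⟩
  rw [linForm_eval] at h3
  simp only
  rw [← hc, Units.smul_def, map_smul, h3, smul_zero]

lemma snoc_comp {K : Type*} (x : Fin 3 → K) (z : K) :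
    (Fin.snoc x z : Fin 4 → K) ∘ Fin.castSucc = x := by
  funext k
  simp

lemma snoc_three {K : Type*} (x : Fin 3 → K) (z : K) : (Fin.snoc x z : Fin 4 → K) 3 = z :=
  Fin.snoc_last (α := fun _ => K) z x

lemma snoc_ext {K : Type*} {v w : Fin 4 → K} (h : v ∘ Fin.castSucc = w ∘ Fin.castSucc)
    (h3 : v 3 = w 3) : v = w := by
  funext i
  exact Fin.lastCases h3 (fun k => congrFun h k) i

lemma no_line {K : Type*} [Field K] [Infinite K] {G B : MvPolynomial (Fin 3) K}
    {m : ℕ} (hG : G.IsHomogeneous m) (hB : B.IsHomogeneous (m + 1))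
    (hfin : (singLocus (zGB G B)).Finite) {x : Fin 3 → K} (hx : x ≠ 0) {z w : K} (hzw : z ≠ w)
    (hz : SV (zGB G B) (Fin.snoc x z : Fin 4 → K)) (hw : SV (zGB G B) (Fin.snoc x w : Fin 4 → K)) : False := by
  rw [SV_zGB, snoc_comp, snoc_three] at hz hw
  have hsv : ∀ u : K, SV (zGB G B) (Fin.snoc x u : Fin 4 → K) := by
    intro u
    rw [SV_zGB, snoc_comp, snoc_three]
    refine ⟨hz.1, hz.2.1, fun k => ?_⟩
    have h1 : eval x (pderiv k G) = 0 := by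
      have : (z - w) * eval x (pderiv k G) = 0 := by linear_combination hz.2.2 k - hw.2.2 k
      exact (mul_eq_zero.1 this).resolve_left (sub_ne_zero.2 hzw)
    have h2 := hz.2.2 k
    rw [h1] at h2 ⊢
    simpa using h2
  have hne : ∀ u : K, (Fin.snoc x u : Fin 4 → K) ≠ 0 := by
    intro u h
    apply hx
    rw [← snoc_comp x u, h]
    rfl
  refine Set.infinite_of_injective_forall_mem
    (f := fun u : K => Projectivization.mk K (Fin.snoc x u : Fin 4 → K) (hne u)) ?_ ?_ hfin
  · intro u u' h
    obtain ⟨a, ha⟩ := (Projectivization.mk_eq_mk_iff' K _ _ (hne u) (hne u')).1 h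
    have e1 : a • x = x := by
      have := congrArg (· ∘ (Fin.castSucc : Fin 3 → Fin 4)) ha
      simp only [snoc_comp] at this
      have h2 := congrArg (a • ·) (snoc_comp x u')
      exact h2.symm.trans this
    have ha1 : a = 1 := by
      obtain ⟨k, hk⟩ := Function.ne_iff.1 hx
      have := congrFun e1 k
      simp only [Pi.smul_apply, smul_eq_mul] at this
      exact mul_right_cancel₀ hk (by rw [this, one_mul])
    have e2 := congrFun ha 3
    rw [ha1, one_smul, snoc_three, snoc_three] at e2
    exact e2.symm
  · intro u
    exact (mk_mem_singLocus (zGB_hom hG hB) (hne u)).2 (hsv u)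

lemma count_zGB {K : Type*} [Field K] [IsAlgClosed K] {G B : MvPolynomial (Fin 3) K}
    {m : ℕ} (hG : G.IsHomogeneous m) (hB : B.IsHomogeneous (m + 1)) (hG0 : G ≠ 0)
    (hfin : (singLocus (zGB G B)).Finite) :
    (singLocus (zGB G B)).ncard ≤ 1 + m * (m + 1) / 2 := by
  have hinf : Infinite K := IsAlgClosed.instInfinite
  have hhom := zGB_hom hG hB
  have hPne : (Fin.snoc 0 1 : Fin 4 → K) ≠ 0 := by
    intro h
    have := congrFun h 3
    rw [snoc_three] at this
    exact one_ne_zero this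
  let P : Projectivization K (Fin 4 → K) := Projectivization.mk K (Fin.snoc 0 1) hPne
  let T := singLocus (zGB G B) \ {P}
  have hT : T.Finite := hfin.subset Set.sdiff_subset
  have h1 : (singLocus (zGB G B)).ncard ≤ T.ncard + 1 := by
    have : (singLocus (zGB G B)).ncard - 1 ≤ T.ncard := Set.pred_ncard_le_ncard_sdiff_singleton _ _
    omega
  have hsv : ∀ p : T, SV (zGB G B) p.1.rep := fun p => by
    rw [← mk_mem_singLocus hhom p.1.rep_nonzero, Projectivization.mk_rep]
    exact p.2.1
  let x : T → Fin 3 → K := fun p => p.1.rep ∘ Fin.castSucc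
  have hx0 : ∀ p, x p ≠ 0 := by
    intro p hp
    apply p.2.2
    rw [Set.mem_singleton_iff, ← Projectivization.mk_rep p.1, Projectivization.mk_eq_mk_iff']
    refine ⟨p.1.rep 3, snoc_ext ?_ ?_⟩
    · have : x p = p.1.rep ∘ Fin.castSucc := rfl
      rw [← this, hp]
      funext k
      have := congrFun (snoc_comp (0 : Fin 3 → K) 1) k
      simp only [Function.comp_apply] at this
      simp only [Function.comp_apply, Pi.smul_apply, this]
      simp
    · rw [Pi.smul_apply, snoc_three, smul_eq_mul, mul_one]
  have hx : ∀ p q, p ≠ q → LinearIndependent K ![x p, x q] := by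
    intro p q hpq
    rw [LinearIndependent.pair_iff' (hx0 p)]
    intro a ha
    have ha0 : a ≠ 0 := by
      rintro rfl
      exact hx0 q (by rw [← ha, zero_smul])
    have hne : a * p.1.rep 3 ≠ q.1.rep 3 := by
      intro h3
      apply hpq
      apply Subtype.ext
      rw [← Projectivization.mk_rep p.1, ← Projectivization.mk_rep q.1, eq_comm,
        Projectivization.mk_eq_mk_iff']
      exact ⟨a, snoc_ext ha h3⟩
    refine no_line hG hB hfin (hx0 q) hne ?_ ?_
    · have := (hsv p).smul hhom a
      convert this using 1
      refine snoc_ext ?_ ?_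
      · rw [snoc_comp, ← ha]; rfl
      · rw [snoc_three]; rfl
    · convert hsv q using 1
      refine snoc_ext ?_ ?_
      · rw [snoc_comp]
      · rw [snoc_three]
  have := hT.fintype
  have hb := bezout_tangent hG hB hG0 (relPrime_of_finite hG hB hG0 hfin) x hx0 hx
    (fun p => ((SV_zGB G B _).1 (hsv p)).1) (fun p => ((SV_zGB G B _).1 (hsv p)).2.1)
    (fun p => p.1.rep 3) (fun p => ((SV_zGB G B _).1 (hsv p)).2.2)
  have hc : T.ncard = Fintype.card T := by
    rw [← Nat.card_coe_set_eq, Nat.card_eq_fintype_card]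
  omega

/-- Let `K` be an algebraically closed field and `d ≥ 2`.  If `X = {F = 0} ⊆ ℙ³_K` is a degree
`d` surface with finite singular locus which has a point of multiplicity `d - 1` (i.e. after a
linear change of coordinates moving that point to `[0:0:0:1]`, `F = z·G(x₁,x₂,x₃) + B(x₁,x₂,x₃)`
with `G ≠ 0` homogeneous of degree `d - 1` and `B` homogeneous of degree `d`), then
`|Sing(X)| ≤ 1 + d(d-1)/2`. -/
theorem singular_count_le_of_multiplicity_pred
    {K : Type*} [Field K] [IsAlgClosed K] (d : ℕ) (hd : 2 ≤ d)
    (F : MvPolynomial (Fin 4) K) (hF0 : F ≠ 0) (hFhom : F.IsHomogeneous d)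
    (hmult : ∃ M : Matrix (Fin 4) (Fin 4) K, IsUnit M.det ∧
      ∃ G B : MvPolynomial (Fin 3) K,
        G.IsHomogeneous (d - 1) ∧ G ≠ 0 ∧ B.IsHomogeneous d ∧
        bind₁ (fun i => ∑ j, C (M i j) * X j) F
          = X 3 * rename (Fin.castLE (by norm_num : (3:ℕ) ≤ 4)) G
            + rename (Fin.castLE (by norm_num : (3:ℕ) ≤ 4)) B)
    (hfin : (singLocus F).Finite) :
    (singLocus F).ncard ≤ 1 + d * (d - 1) / 2 := by
  obtain ⟨M, hM, G, B, hG, hG0, hB, hE⟩ := hmult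
  obtain ⟨m, rfl⟩ : ∃ m, d = m + 1 := ⟨d - 1, by omega⟩
  rw [Nat.add_sub_cancel] at hG ⊢
  change _ = zGB G B at hE
  have hhom := zGB_hom hG hB
  have hinj : Function.Injective M.mulVecLin :=
    Matrix.mulVec_injective_of_isUnit ((Matrix.isUnit_iff_isUnit_det M).2 hM)
  have himg : singLocus F = Projectivization.map M.mulVecLin hinj '' singLocus (zGB G B) := by
    ext p
    constructor
    · intro hp
      have hr := (mk_mem_singLocus hFhom p.rep_nonzero).1 (by rwa [Projectivization.mk_rep])
      have hMi : M.mulVec (M⁻¹.mulVec p.rep) = p.rep := by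
        rw [Matrix.mulVec_mulVec, Matrix.mul_nonsing_inv _ hM, Matrix.one_mulVec]
      have hne : M⁻¹.mulVec p.rep ≠ 0 := by
        intro h
        rw [h, Matrix.mulVec_zero] at hMi
        exact p.rep_nonzero hMi.symm
      refine ⟨Projectivization.mk K (M⁻¹.mulVec p.rep) hne, ?_, ?_⟩
      · rw [mk_mem_singLocus hhom, ← hE, SV_linear M hM, hMi]
        exact hr
      · rw [Projectivization.map_mk]
        conv_rhs => rw [← Projectivization.mk_rep p]
        congr 1
    · rintro ⟨q, hq, rfl⟩
      have hr := (mk_mem_singLocus hhom q.rep_nonzero).1 (by rwa [Projectivization.mk_rep])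
      rw [← Projectivization.mk_rep q, Projectivization.map_mk, mk_mem_singLocus hFhom]
      rw [← hE, SV_linear M hM] at hr
      exact hr
  have hmi := Projectivization.map_injective M.mulVecLin hinj
  rw [himg, Set.ncard_image_of_injective _ hmi, mul_comm]
  rw [himg] at hfin
  exact count_zGB hG hB hG0 (hfin.of_finite_image hmi.injOn)

end
end

section
/- Let K be an algebraically closed field of characteristic 2 and let X = {F = 0} ⊂ ℙ³_K be an irreducible quartic surface with Sing(X) finite. Suppose X has a double point at P = [0:0:0:1] with F(x₁,x₂,x₃,z) = z²·Q(x₁,x₂,x₃) + B(x₁,x₂,x₃) (i.e. the cubic term G vanishes identically, so the projection from P is an inseparable double cover of ℙ²). Then |Sing(X)| ≤ 16. -/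
open MvPolynomial

noncomputable section

section Covering

/-- `Cov K n T`: up to scalars, the set `T` consists of at most `n` vectors. -/
def Cov (K : Type*) [Field K] {V : Type*} [AddCommGroup V] [Module K V] (n : ℕ) (T : Set V) : Prop :=
  ∃ L : Finset V, L.card ≤ n ∧ ∀ v ∈ T, ∃ q ∈ L, ∃ k : K, v = k • q

variable {K : Type*} [Field K] {V : Type*} [AddCommGroup V] [Module K V]

theorem Cov.mono {n m : ℕ} {T S : Set V} (h : Cov K n T) (hnm : n ≤ m) (hST : S ⊆ T) :
    Cov K m S := by
  obtain ⟨L, hL, h⟩ := h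
  exact ⟨L, hL.trans hnm, fun v hv => h v (hST hv)⟩

theorem Cov.union {n m : ℕ} {T S : Set V} (h : Cov K n T) (h' : Cov K m S) :
    Cov K (n + m) (T ∪ S) := by
  classical
  obtain ⟨L, hL, h⟩ := h
  obtain ⟨M, hM, h'⟩ := h'
  refine ⟨L ∪ M, (Finset.card_union_le _ _).trans (by omega), ?_⟩
  rintro v (hv | hv)
  · obtain ⟨q, hq, k, hk⟩ := h v hv
    exact ⟨q, Finset.mem_union_left _ hq, k, hk⟩
  · obtain ⟨q, hq, k, hk⟩ := h' v hv
    exact ⟨q, Finset.mem_union_right _ hq, k, hk⟩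

theorem Cov.biUnion {n m : ℕ} {ι : Type*} (I : Finset ι) (hI : I.card ≤ n) (T : ι → Set V)
    (h : ∀ i ∈ I, Cov K m (T i)) : Cov K (n * m) {v | ∃ i ∈ I, v ∈ T i} := by
  classical
  choose! L hL h using h
  refine ⟨I.biUnion L, ?_, ?_⟩
  · exact (Finset.card_biUnion_le_card_mul _ _ m (fun i hi => hL i hi)).trans
      (Nat.mul_le_mul_right _ hI)
  · rintro v ⟨i, hi, hv⟩
    obtain ⟨q, hq, k, hk⟩ := h i hi v hv
    exact ⟨q, Finset.mem_biUnion.2 ⟨i, hi, hq⟩, k, hk⟩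

theorem Cov.map {n : ℕ} {W : Type*} [AddCommGroup W] [Module K W] {T : Set V} {S : Set W}
    (h : Cov K n T) (f : V →ₗ[K] W) (hf : ∀ w ∈ S, ∃ v ∈ T, f v = w) : Cov K n S := by
  classical
  obtain ⟨L, hL, h⟩ := h
  refine ⟨L.image f, Finset.card_image_le.trans hL, ?_⟩
  intro w hw
  obtain ⟨v, hv, rfl⟩ := hf w hw
  obtain ⟨q, hq, k, rfl⟩ := h v hv
  exact ⟨f q, Finset.mem_image_of_mem _ hq, k, by simp⟩

theorem Cov.false {n : ℕ} {T : Set V} (h : Cov K n T) (f : K → V)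
    (hinj : ∀ u u' k : K, f u = k • f u' → u = u') (hinf : {u | f u ∈ T}.Infinite) : False := by
  obtain ⟨L, hL, h⟩ := h
  choose! q hq k hk using h
  have hmap : Set.MapsTo (fun u => q (f u)) {u | f u ∈ T} (L : Set V) := fun u hu => hq _ hu
  obtain ⟨u, hu, u', hu', hne, he⟩ :=
    hinf.exists_ne_map_eq_of_mapsTo hmap L.finite_toSet
  apply hne
  have h1 := hk _ hu
  have h2 := hk _ hu'
  by_cases h0 : k (f u') = 0
  · have h3 : f u' = (0 : K) • f u := by rw [h2, h0, zero_smul, zero_smul]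
    exact (hinj _ _ _ h3).symm
  · refine hinj u u' (k (f u) * (k (f u'))⁻¹) ?_
    have h4 : (k (f u'))⁻¹ • f u' = q (f u') := by
      conv_lhs => arg 2; rw [h2]
      exact inv_smul_smul₀ h0 _
    rw [mul_smul, h4, ← he]
    exact h1

theorem Cov.poly {m n : ℕ} {T : Set V} (h : Cov K m T) (f : K → V) (p : Polynomial K)
    (hp : p.natDegree ≤ n)
    (hinj : ∀ u u' k : K, f u = k • f u' → u = u')
    (h1 : p = 0 → {u | f u ∈ T}.Infinite) (S : Set V)
    (h2 : ∀ v ∈ S, ∃ u k : K, p.eval u = 0 ∧ v = k • f u) : Cov K n S := by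
  classical
  by_cases h0 : p = 0
  · exact (h.false f hinj (h1 h0)).elim
  · refine ⟨p.roots.toFinset.image f, ?_, ?_⟩
    · exact Finset.card_image_le.trans ((Multiset.toFinset_card_le _).trans
        ((Polynomial.card_roots' p).trans hp))
    · intro v hv
      obtain ⟨u, k, hu, hk⟩ := h2 v hv
      refine ⟨f u, Finset.mem_image_of_mem _ ?_, k, hk⟩
      simp [h0, hu]

theorem exists_sqrt_fun [IsAlgClosed K] : ∃ r : K → K, ∀ a, r a ^ 2 = a := by
  have : ∀ a : K, ∃ z, z ^ 2 = a := fun a => IsAlgClosed.exists_pow_nat_eq a (by norm_num)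
  choose r hr using this
  exact ⟨r, hr⟩

theorem char_two_sq_inj [CharP K 2] {a b : K} (h : a ^ 2 = b ^ 2) : a = b :=
  frobenius_inj K 2 (by simpa [frobenius_def] using h)

end Covering
section Core

/-- Coefficients of `Q` and `B` in normalized coordinates. -/
structure Dat (K : Type*) where
  (c q1 q2 q3 b40 b31 b22 b13 b04 a30 a21 a12 a03 e20 e11 e02 c1 d1 e0 : K)

variable {K : Type*} [Field K]

/-- The affine cone over the singular locus, in normalized coordinates `(x, y, t, z)`. -/
def Dat.S (D : Dat K) : Set (K × K × K × K) :=
  {v | ∃ x y t z : K, v = (x, y, t, z) ∧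
    z ^ 2 * (D.c * y) + (D.b31 * x ^ 2 * y + D.b13 * y ^ 3 + t * (D.a30 * x ^ 2 + D.a12 * y ^ 2)
      + t ^ 2 * (D.e11 * y) + t ^ 3 * D.c1) = 0 ∧
    z ^ 2 * (D.c * x) + (D.b31 * x ^ 3 + D.b13 * x * y ^ 2 + t * (D.a21 * x ^ 2 + D.a03 * y ^ 2)
      + t ^ 2 * (D.e11 * x) + t ^ 3 * D.d1) = 0 ∧
    D.a30 * x ^ 3 + D.a21 * x ^ 2 * y + D.a12 * x * y ^ 2 + D.a03 * y ^ 3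
      + t ^ 2 * (D.c1 * x + D.d1 * y) = 0 ∧
    z ^ 2 * (D.q1 * x ^ 2 + D.q2 * y ^ 2 + D.q3 * t ^ 2 + D.c * x * y)
      + (D.b40 * x ^ 4 + D.b31 * x ^ 3 * y + D.b22 * x ^ 2 * y ^ 2 + D.b13 * x * y ^ 3
        + D.b04 * y ^ 4
      + t ^ 2 * (D.e20 * x ^ 2 + D.e11 * x * y + D.e02 * y ^ 2) + D.e0 * t ^ 4) = 0}

theorem Dat.S_smul (D : Dat K) (k x y t z : K) (h : (x, y, t, z) ∈ D.S) :
    (k * x, k * y, k * t, k * z) ∈ D.S := by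
  obtain ⟨_, _, _, _, he, h1, h2, h3, h4⟩ := h
  simp only [Prod.mk.injEq] at he
  obtain ⟨rfl, rfl, rfl, rfl⟩ := he
  refine ⟨_, _, _, _, rfl, ?_, ?_, ?_, ?_⟩
  · linear_combination k ^ 3 * h1
  · linear_combination k ^ 3 * h2
  · linear_combination k ^ 3 * h3
  · linear_combination k ^ 4 * h4

theorem Dat.S_iff1 [CharP K 2] (D : Dat K) (u t z : K) (hc : D.d1 = 0) :
    ((1, u, t, z) : K × K × K × K) ∈ D.S ↔
    z ^ 2 * D.c + (D.b31 + D.b13 * u ^ 2 + t * (D.a21 + D.a03 * u ^ 2) + t ^ 2 * D.e11) = 0 ∧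
    D.a30 + D.a21 * u + D.a12 * u ^ 2 + D.a03 * u ^ 3 + t ^ 2 * D.c1 = 0 ∧
    z ^ 2 * (D.q1 + D.q2 * u ^ 2 + D.q3 * t ^ 2 + D.c * u)
      + (D.b40 + D.b31 * u + D.b22 * u ^ 2 + D.b13 * u ^ 3 + D.b04 * u ^ 4
      + t ^ 2 * (D.e20 + D.e11 * u + D.e02 * u ^ 2) + D.e0 * t ^ 4) = 0 := by
  have h2 : (2 : K) = 0 := CharTwo.two_eq_zero
  constructor
  · rintro ⟨_, _, _, _, he, e1, e2, e3, e4⟩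
    simp only [Prod.mk.injEq] at he
    obtain ⟨rfl, rfl, rfl, rfl⟩ := he
    refine ⟨?_, ?_, ?_⟩
    · linear_combination e2 - t ^ 3 * hc
    · linear_combination e3 - t ^ 2 * u * hc
    · linear_combination e4
  · rintro ⟨e1, e2, e3⟩
    refine ⟨_, _, _, _, rfl, ?_, ?_, ?_, ?_⟩
    · linear_combination u * e1 + t * e2 - t * (D.a21 * u + D.a03 * u ^ 3) * h2
    · linear_combination e1 + t ^ 3 * hc
    · linear_combination e2 + t ^ 2 * u * hc
    · linear_combination e3

theorem Dat.S_iff2 (D : Dat K) (t z : K) (hc : D.d1 = 0) :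
    ((0, 1, t, z) : K × K × K × K) ∈ D.S ↔
    z ^ 2 * D.c + (D.b13 + t * D.a12 + t ^ 2 * D.e11 + t ^ 3 * D.c1) = 0 ∧
    D.a03 = 0 ∧
    z ^ 2 * (D.q2 + D.q3 * t ^ 2) + (D.b04 + t ^ 2 * D.e02 + D.e0 * t ^ 4) = 0 := by
  constructor
  · rintro ⟨_, _, _, _, he, e1, e2, e3, e4⟩
    simp only [Prod.mk.injEq] at he
    obtain ⟨rfl, rfl, rfl, rfl⟩ := he
    refine ⟨?_, ?_, ?_⟩
    · linear_combination e1
    · linear_combination e3 - t ^ 2 * hc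
    · linear_combination e4
  · rintro ⟨e1, e2, e3⟩
    refine ⟨_, _, _, _, rfl, ?_, ?_, ?_, ?_⟩
    · linear_combination e1
    · linear_combination t ^ 3 * hc + t * e2
    · linear_combination e2 + t ^ 2 * hc
    · linear_combination e3

theorem Dat.S_iff3 (D : Dat K) (z : K) (hc : D.d1 = 0) :
    ((0, 0, 1, z) : K × K × K × K) ∈ D.S ↔ D.c1 = 0 ∧ z ^ 2 * D.q3 + D.e0 = 0 := by
  constructor
  · rintro ⟨_, _, _, _, he, e1, e2, e3, e4⟩
    simp only [Prod.mk.injEq] at he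
    obtain ⟨rfl, rfl, rfl, rfl⟩ := he
    refine ⟨?_, ?_⟩
    · linear_combination e1
    · linear_combination e4
  · rintro ⟨e1, e2⟩
    refine ⟨_, _, _, _, rfl, ?_, ?_, ?_, ?_⟩
    · linear_combination e1
    · linear_combination hc
    · ring
    · linear_combination e2

/-- Splitting the count over the standard charts of projective space. -/
theorem Dat.cov_split (D : Dat K) {n1 n2 n3 : ℕ}
    (h1 : Cov K n1 {v | ∃ u t z : K, v = (1, u, t, z) ∧ v ∈ D.S})
    (h2 : Cov K n2 {v | ∃ t z : K, v = (0, 1, t, z) ∧ v ∈ D.S})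
    (h3 : Cov K n3 {v | ∃ z : K, v = (0, 0, 1, z) ∧ v ∈ D.S}) :
    Cov K (n1 + n2 + n3 + 1) D.S := by
  have h4 : Cov K 1 {((0, 0, 0, 1) : K × K × K × K)} :=
    ⟨{(0, 0, 0, 1)}, by simp, fun v hv => ⟨v, by simpa using hv, 1, by simp⟩⟩
  obtain ⟨L, hL, h⟩ := ((h1.union h2).union h3).union h4
  refine ⟨L, hL, ?_⟩
  rintro ⟨x, y, t, z⟩ hv
  have key : ∀ k : K, k ≠ 0 → ∀ w : K × K × K × K,
      w = (k⁻¹ * x, k⁻¹ * y, k⁻¹ * t, k⁻¹ * z) → (∃ q ∈ L, ∃ k : K, w = k • q) →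
      ∃ q ∈ L, ∃ k : K, (x, y, t, z) = k • q := by
    rintro k hk w rfl ⟨q, hq, k', hw⟩
    refine ⟨q, hq, k * k', ?_⟩
    rw [mul_smul, ← hw]
    simp [hk]
  by_cases hx : x = 0
  · by_cases hy : y = 0
    · by_cases ht : t = 0
      · obtain ⟨q, hq, k, hk⟩ := h (0, 0, 0, 1) (Or.inr rfl)
        refine ⟨q, hq, z * k, ?_⟩
        rw [mul_smul, ← hk]
        simp [hx, hy, ht]
      · refine key t ht _ rfl (h _ ?_)
        refine Or.inl (Or.inr ⟨t⁻¹ * z, ?_, D.S_smul _ _ _ _ _ hv⟩)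
        simp [hx, hy, ht]
    · refine key y hy _ rfl (h _ ?_)
      refine Or.inl (Or.inl (Or.inr ⟨y⁻¹ * t, y⁻¹ * z, ?_, D.S_smul _ _ _ _ _ hv⟩))
      simp [hx, hy]
  · refine key x hx _ rfl (h _ ?_)
    refine Or.inl (Or.inl (Or.inl ⟨x⁻¹ * y, x⁻¹ * t, x⁻¹ * z, ?_, D.S_smul _ _ _ _ _ hv⟩))
    simp [hx]

end Core
namespace Polynomial

variable {K : Type*} [Field K]

theorem _root_.inj1 (g : K → K × K) (u u' k : K)
    (h : ((1, u, g u) : K × K × K × K) = k • (1, u', g u')) : u = u' := by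
  simp only [Prod.smul_mk, Prod.mk.injEq, smul_eq_mul] at h
  obtain ⟨h1, h2, -⟩ := h
  rw [h2, ← one_mul u', ← mul_assoc, ← h1]

theorem _root_.inj2 (a b : K) (hab : a = 1 ∨ b = 1) (g : K → K) (u u' k : K)
    (h : ((a, b, u, g u) : K × K × K × K) = k • (a, b, u', g u')) : u = u' := by
  simp only [Prod.smul_mk, Prod.mk.injEq, smul_eq_mul] at h
  obtain ⟨h1, h2, h3, -⟩ := h
  have : k = 1 := by
    rcases hab with rfl | rfl
    · simpa using h1.symm
    · simpa using h2.symm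
  rw [h3, this, one_mul]

theorem _root_.inj3 (a b c : K) (hab : a = 1 ∨ b = 1 ∨ c = 1) (u u' k : K)
    (h : ((a, b, c, u) : K × K × K × K) = k • (a, b, c, u')) : u = u' := by
  simp only [Prod.smul_mk, Prod.mk.injEq, smul_eq_mul] at h
  obtain ⟨h1, h2, h3, h4⟩ := h
  have : k = 1 := by
    rcases hab with rfl | rfl | rfl
    · simpa using h1.symm
    · simpa using h2.symm
    · simpa using h3.symm
  rw [h4, this, one_mul]

/-- The fibre over the point `(0 : 1)`. -/
theorem _root_.Dat.chart2 [IsAlgClosed K] [CharP K 2] (D : Dat K) (hd : D.d1 = 0) (hc : D.c ≠ 0)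
    {m : ℕ} (hfin : Cov K m D.S) (n : ℕ) (hn : 5 ≤ n ∨ (D.c1 = 0 ∧ 4 ≤ n)) (ha : D.a03 = 0) :
    Cov K n {v | ∃ t z : K, v = (0, 1, t, z) ∧ v ∈ D.S} := by
  obtain ⟨r, hr⟩ := exists_sqrt_fun (K := K)
  let p : K[X] := (C D.b13 + X * C D.a12 + X ^ 2 * C D.e11 + X ^ 3 * C D.c1) *
    (C D.q2 + C D.q3 * X ^ 2) - C D.c * (C D.b04 + X ^ 2 * C D.e02 + C D.e0 * X ^ 4)
  let w : K → K := fun t => -(D.b13 + t * D.a12 + t ^ 2 * D.e11 + t ^ 3 * D.c1) / D.c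
  have hw : ∀ t, w t * D.c = -(D.b13 + t * D.a12 + t ^ 2 * D.e11 + t ^ 3 * D.c1) := fun t =>
    div_mul_cancel₀ _ hc
  have hpe : ∀ t, p.eval t = (D.b13 + t * D.a12 + t ^ 2 * D.e11 + t ^ 3 * D.c1) *
    (D.q2 + D.q3 * t ^ 2) - D.c * (D.b04 + t ^ 2 * D.e02 + D.e0 * t ^ 4) := by
    intro t; simp only [p, eval_sub, eval_mul, eval_add, eval_C, eval_X, eval_pow]
  have hiff : ∀ t, p.eval t = 0 → ((0, 1, t, r (w t)) : K × K × K × K) ∈ D.S := by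
    intro t ht
    rw [hpe] at ht
    rw [D.S_iff2 _ _ hd, hr]
    refine ⟨by rw [hw]; ring, ha, ?_⟩
    apply mul_left_cancel₀ hc
    linear_combination (D.q2 + D.q3 * t ^ 2) * hw t - ht
  refine hfin.poly (fun t => (0, 1, t, r (w t))) p ?_ (inj2 0 1 (Or.inr rfl) _) ?_ _ ?_
  · rcases hn with hn | ⟨h0, hn⟩
    · refine le_trans ?_ hn
      simp only [p]; compute_degree
    · refine le_trans ?_ hn
      simp only [p, h0, map_zero, mul_zero, add_zero]; compute_degree
  · intro hp
    have : {u : K | ((0, 1, u, r (w u)) : K × K × K × K) ∈ D.S} = Set.univ := by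
      ext u; simp [hiff, hp]
    rw [this]; exact Set.infinite_univ
  · rintro _ ⟨t, z, rfl, hv⟩
    rw [D.S_iff2 _ _ hd] at hv
    obtain ⟨e1, e2, e3⟩ := hv
    refine ⟨t, 1, ?_, ?_⟩
    · rw [hpe]
      linear_combination (D.q2 + D.q3 * t ^ 2) * e1 - D.c * e3
    · have : z = r (w t) := by
        apply char_two_sq_inj
        rw [hr]
        apply mul_right_cancel₀ hc
        rw [hw]; linear_combination e1
      simp [this]

/-- The fibre over a point `(1 : u)`, when it is a component of the polar cubic. -/
theorem _root_.Dat.chart1_fibre [IsAlgClosed K] [CharP K 2] (D : Dat K) (hd : D.d1 = 0) (hc : D.c ≠ 0)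
    (hc1 : D.c1 = 0) {m : ℕ} (hfin : Cov K m D.S) (u : K)
    (hu : D.a30 + D.a21 * u + D.a12 * u ^ 2 + D.a03 * u ^ 3 = 0) :
    Cov K 4 {v | ∃ t z : K, v = (1, u, t, z) ∧ v ∈ D.S} := by
  obtain ⟨r, hr⟩ := exists_sqrt_fun (K := K)
  let p : K[X] := (C (D.b31 + D.b13 * u ^ 2) + X * C (D.a21 + D.a03 * u ^ 2) + X ^ 2 * C D.e11) *
    (C (D.q1 + D.q2 * u ^ 2 + D.c * u) + C D.q3 * X ^ 2) -
    C D.c * (C (D.b40 + D.b31 * u + D.b22 * u ^ 2 + D.b13 * u ^ 3 + D.b04 * u ^ 4)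
      + X ^ 2 * C (D.e20 + D.e11 * u + D.e02 * u ^ 2) + C D.e0 * X ^ 4)
  let w : K → K := fun t => -(D.b31 + D.b13 * u ^ 2 + t * (D.a21 + D.a03 * u ^ 2)
    + t ^ 2 * D.e11) / D.c
  have hw : ∀ t, w t * D.c = -(D.b31 + D.b13 * u ^ 2 + t * (D.a21 + D.a03 * u ^ 2)
    + t ^ 2 * D.e11) := fun t => div_mul_cancel₀ _ hc
  have hpe : ∀ t, p.eval t = (D.b31 + D.b13 * u ^ 2 + t * (D.a21 + D.a03 * u ^ 2)
    + t ^ 2 * D.e11) * (D.q1 + D.q2 * u ^ 2 + D.c * u + D.q3 * t ^ 2) -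
    D.c * (D.b40 + D.b31 * u + D.b22 * u ^ 2 + D.b13 * u ^ 3 + D.b04 * u ^ 4
      + t ^ 2 * (D.e20 + D.e11 * u + D.e02 * u ^ 2) + D.e0 * t ^ 4) := by
    intro t; simp only [p, eval_sub, eval_mul, eval_add, eval_C, eval_X, eval_pow]
  have hiff : ∀ t, p.eval t = 0 → ((1, u, t, r (w t)) : K × K × K × K) ∈ D.S := by
    intro t ht
    rw [hpe] at ht
    rw [D.S_iff1 _ _ _ hd, hr]
    refine ⟨by rw [hw]; ring, by rw [hc1]; linear_combination hu, ?_⟩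
    apply mul_left_cancel₀ hc
    linear_combination (D.q1 + D.q2 * u ^ 2 + D.c * u + D.q3 * t ^ 2) * hw t - ht
  refine hfin.poly (fun t => (1, u, t, r (w t))) p ?_ (inj2 1 u (Or.inl rfl) _) ?_ _ ?_
  · simp only [p]; compute_degree
  · intro hp
    have : {t : K | ((1, u, t, r (w t)) : K × K × K × K) ∈ D.S} = Set.univ := by
      ext u; simp [hiff, hp]
    rw [this]; exact Set.infinite_univ
  · rintro _ ⟨t, z, rfl, hv⟩
    rw [D.S_iff1 _ _ _ hd] at hv
    obtain ⟨e1, e2, e3⟩ := hv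
    refine ⟨t, 1, ?_, ?_⟩
    · rw [hpe]
      linear_combination (D.q1 + D.q2 * u ^ 2 + D.c * u + D.q3 * t ^ 2) * e1 - D.c * e3
    · have : z = r (w t) := by
        apply char_two_sq_inj
        rw [hr]
        apply mul_right_cancel₀ hc
        rw [hw]; linear_combination e1
      simp [this]

/-- The main chart, in the generic case. -/
theorem _root_.Dat.chart1 [IsAlgClosed K] [CharP K 2] (D : Dat K) (hd : D.d1 = 0) (hc : D.c ≠ 0)
    (hc1 : D.c1 ≠ 0) {m : ℕ} (hfin : Cov K m D.S) (n : ℕ) (hn : 13 ≤ n ∨ (D.a03 = 0 ∧ 8 ≤ n)) :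
    Cov K n {v | ∃ u t z : K, v = (1, u, t, z) ∧ v ∈ D.S} := by
  have h2 : (2 : K) = 0 := CharTwo.two_eq_zero
  obtain ⟨r, hr⟩ := exists_sqrt_fun (K := K)
  let s : K[X] := C (-D.c1⁻¹) * (C D.a30 + C D.a21 * X + C D.a12 * X ^ 2 + C D.a03 * X ^ 3)
  let M : K[X] := C D.q1 + C D.q2 * X ^ 2 + C D.c * X + C D.q3 * s
  let R : K[X] := C D.a21 + C D.a03 * X ^ 2
  let E2 : K[X] := C D.e20 + C D.e11 * X + C D.e02 * X ^ 2
  let E4 : K[X] := C D.b40 + C D.b31 * X + C D.b22 * X ^ 2 + C D.b13 * X ^ 3 + C D.b04 * X ^ 4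
  let S' : K[X] := C D.b31 + C D.b13 * X ^ 2
  let A : K[X] := (S' + C D.e11 * s) * M - C D.c * (E4 + s * E2 + C D.e0 * s ^ 2)
  let A' : K[X] := R * M
  let p : K[X] := A ^ 2 - s * A' ^ 2
  have hs : ∀ u, D.a30 + D.a21 * u + D.a12 * u ^ 2 + D.a03 * u ^ 3 + s.eval u * D.c1 = 0 := by
    intro u
    simp only [s, eval_mul, eval_add, eval_C, eval_X, eval_pow]
    field_simp
    ring
  let τ : K → K := fun u => r (s.eval u)
  have hτ : ∀ u, τ u ^ 2 = s.eval u := fun u => hr _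
  let w : K → K := fun u => -(D.b31 + D.b13 * u ^ 2 + τ u * (D.a21 + D.a03 * u ^ 2)
    + τ u ^ 2 * D.e11) / D.c
  have hw : ∀ u, w u * D.c = -(D.b31 + D.b13 * u ^ 2 + τ u * (D.a21 + D.a03 * u ^ 2)
    + τ u ^ 2 * D.e11) := fun t => div_mul_cancel₀ _ hc
  have hpe : ∀ u, p.eval u = ((D.b31 + D.b13 * u ^ 2 + τ u * (D.a21 + D.a03 * u ^ 2)
    + τ u ^ 2 * D.e11) * (D.q1 + D.q2 * u ^ 2 + D.c * u + D.q3 * τ u ^ 2) -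
    D.c * (D.b40 + D.b31 * u + D.b22 * u ^ 2 + D.b13 * u ^ 3 + D.b04 * u ^ 4
      + τ u ^ 2 * (D.e20 + D.e11 * u + D.e02 * u ^ 2) + D.e0 * τ u ^ 4)) ^ 2 := by
    intro u
    have hA : A.eval u = (D.b31 + D.b13 * u ^ 2 + D.e11 * τ u ^ 2) *
      (D.q1 + D.q2 * u ^ 2 + D.c * u + D.q3 * τ u ^ 2) -
      D.c * (D.b40 + D.b31 * u + D.b22 * u ^ 2 + D.b13 * u ^ 3 + D.b04 * u ^ 4
      + τ u ^ 2 * (D.e20 + D.e11 * u + D.e02 * u ^ 2) + D.e0 * (τ u ^ 2) ^ 2) := by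
      rw [hτ]
      simp only [A, S', M, E2, E4, eval_sub, eval_mul, eval_add, eval_C, eval_X, eval_pow]
    have hA' : A'.eval u = (D.a21 + D.a03 * u ^ 2) *
      (D.q1 + D.q2 * u ^ 2 + D.c * u + D.q3 * τ u ^ 2) := by
      rw [hτ]
      simp only [A', R, M, eval_mul, eval_add, eval_C, eval_X, eval_pow]
    have hp1 : p.eval u = A.eval u ^ 2 - τ u ^ 2 * A'.eval u ^ 2 := by
      rw [hτ]; simp only [p, eval_sub, eval_mul, eval_pow]
    have hp2 : p.eval u = (A.eval u + τ u * A'.eval u) ^ 2 := by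
      rw [hp1]
      linear_combination (-(τ u ^ 2 * A'.eval u ^ 2) - A.eval u * τ u * A'.eval u) * h2
    rw [hp2, hA, hA']
    ring
  have hiff : ∀ u, p.eval u = 0 → ((1, u, τ u, r (w u)) : K × K × K × K) ∈ D.S := by
    intro u ht
    rw [hpe] at ht
    replace ht := pow_eq_zero_iff (two_ne_zero) |>.1 ht
    rw [D.S_iff1 _ _ _ hd, hr]
    refine ⟨by rw [hw]; ring, by rw [hτ]; exact hs u, ?_⟩
    apply mul_left_cancel₀ hc
    linear_combination (D.q1 + D.q2 * u ^ 2 + D.c * u + D.q3 * τ u ^ 2) * hw u - ht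
  have hdeg : ∀ ds dM dR dA dp : ℕ, s.natDegree ≤ ds → M.natDegree ≤ dM → R.natDegree ≤ dR →
      max 2 ds + dM ≤ dA → 4 ≤ dA → ds + 2 ≤ dA → 2 * ds ≤ dA → 2 * dA ≤ dp →
      ds + 2 * (dR + dM) ≤ dp → p.natDegree ≤ dp := by
    intro ds dM dR dA dp hs hM hR h1 h2 h3 h4 h5 h6
    have hE2 : E2.natDegree ≤ 2 := by simp only [E2]; compute_degree
    have hE4 : E4.natDegree ≤ 4 := by simp only [E4]; compute_degree
    have hS : S'.natDegree ≤ 2 := by simp only [S']; compute_degree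
    have hA : A.natDegree ≤ dA := by
      refine (natDegree_sub_le _ _).trans (max_le ?_ ?_)
      · refine (natDegree_mul_le_of_le (natDegree_add_le_of_le hS
          (natDegree_C_mul_le _ _)) hM).trans ?_
        exact le_trans (by gcongr) h1
      · refine (natDegree_C_mul_le _ _).trans ?_
        refine natDegree_add_le_of_degree_le (natDegree_add_le_of_degree_le (hE4.trans h2)
          ((natDegree_mul_le_of_le hs hE2).trans h3)) ?_
        exact (natDegree_C_mul_le _ _).trans ((natDegree_pow_le_of_le 2 hs).trans h4)
    refine (natDegree_sub_le _ _).trans (max_le ?_ ?_)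
    · exact (natDegree_pow_le_of_le 2 hA).trans h5
    · exact (natDegree_mul_le_of_le hs (natDegree_pow_le_of_le 2
        (natDegree_mul_le_of_le hR hM))).trans h6
  refine hfin.poly (fun u => (1, u, τ u, r (w u))) p ?_ (inj1 (fun u => (τ u, r (w u)))) ?_ _ ?_
  · rcases hn with hn | ⟨h0, hn⟩
    · refine le_trans ?_ hn
      refine hdeg 3 3 2 6 13 ?_ ?_ ?_ (by norm_num) (by norm_num) (by norm_num) (by norm_num)
        (by norm_num) (by norm_num)
      · simp only [s]; compute_degree
      · simp only [M, s]; compute_degree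
      · simp only [R]; compute_degree
    · refine le_trans ?_ hn
      refine hdeg 2 2 0 4 8 ?_ ?_ ?_ (by norm_num) (by norm_num) (by norm_num) (by norm_num)
        (by norm_num) (by norm_num)
      · simp only [s, h0, map_zero, zero_mul, add_zero]; compute_degree
      · simp only [M, s, h0, map_zero, zero_mul, add_zero]; compute_degree
      · simp only [R, h0, map_zero, zero_mul, add_zero]; compute_degree
  · intro hp
    have : {u : K | ((1, u, τ u, r (w u)) : K × K × K × K) ∈ D.S} = Set.univ := by
      ext u; simp [hiff, hp]
    rw [this]; exact Set.infinite_univ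
  · rintro _ ⟨u, t, z, rfl, hv⟩
    rw [D.S_iff1 _ _ _ hd] at hv
    obtain ⟨e1, e2, e3⟩ := hv
    have ht : t = τ u := by
      apply char_two_sq_inj
      rw [hτ]
      apply mul_right_cancel₀ hc1
      linear_combination e2 - hs u
    subst ht
    refine ⟨u, 1, ?_, ?_⟩
    · rw [hpe, pow_eq_zero_iff (two_ne_zero)]
      linear_combination (D.q1 + D.q2 * u ^ 2 + D.c * u + D.q3 * τ u ^ 2) * e1 - D.c * e3
    · have : z = r (w u) := by
        apply char_two_sq_inj
        rw [hr]
        apply mul_right_cancel₀ hc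
        rw [hw]; linear_combination e1
      simp [this]

end Polynomial
namespace Polynomial

variable {K : Type*} [Field K]

theorem _root_.infinite_nonroots [IsAlgClosed K] {p : K[X]} (hp : p ≠ 0) :
    {u | p.eval u ≠ 0}.Infinite := by
  have := (Polynomial.finite_setOfPred_isRoot hp).infinite_compl
  exact this

theorem _root_.cov_empty (n : ℕ) (T : Set (K × K × K × K)) (h : ∀ v ∈ T, False) : Cov K n T :=
  ⟨∅, by simp, fun v hv => (h v hv).elim⟩

theorem _root_.Dat.chart3 [IsAlgClosed K] (D : Dat K) (hd : D.d1 = 0)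
    (hc1 : D.c1 = 0) {m : ℕ} (hfin : Cov K m D.S) :
    Cov K 2 {v | ∃ z : K, v = (0, 0, 1, z) ∧ v ∈ D.S} := by
  let p : K[X] := X ^ 2 * C D.q3 + C D.e0
  have hp : ∀ z, p.eval z = z ^ 2 * D.q3 + D.e0 := fun z => by
    simp only [p, eval_mul, eval_add, eval_C, eval_X, eval_pow]
  refine hfin.poly (fun z => (0, 0, 1, z)) p (by simp only [p]; compute_degree)
    (inj3 0 0 1 (by simp)) ?_ _ ?_
  · intro h0
    have : {u : K | ((0, 0, 1, u) : K × K × K × K) ∈ D.S} = Set.univ := by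
      ext u
      have := hp u
      simp [D.S_iff3 _ hd, hc1, ← hp, h0]
    rw [this]; exact Set.infinite_univ
  · rintro _ ⟨z, rfl, hv⟩
    rw [D.S_iff3 _ hd] at hv
    exact ⟨z, 1, by rw [hp]; exact hv.2, by simp⟩

theorem _root_.Dat.case_generic [IsAlgClosed K] [CharP K 2] (D : Dat K) (hd : D.d1 = 0)
    (hc : D.c ≠ 0) (hc1 : D.c1 ≠ 0) {m : ℕ} (hfin : Cov K m D.S) : Cov K 16 D.S := by
  have h3 : Cov K 0 {v | ∃ z : K, v = (0, 0, 1, z) ∧ v ∈ D.S} := by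
    refine cov_empty _ _ ?_
    rintro _ ⟨z, rfl, hv⟩
    rw [D.S_iff3 _ hd] at hv
    exact hc1 hv.1
  by_cases ha : D.a03 = 0
  · exact (D.cov_split (D.chart1 hd hc hc1 hfin 8 (Or.inr ⟨ha, le_rfl⟩))
      (D.chart2 hd hc hfin 5 (Or.inl le_rfl) ha) h3).mono (by norm_num) subset_rfl
  · have h2 : Cov K 0 {v | ∃ t z : K, v = (0, 1, t, z) ∧ v ∈ D.S} := by
      refine cov_empty _ _ ?_
      rintro _ ⟨t, z, rfl, hv⟩
      rw [D.S_iff2 _ _ hd] at hv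
      exact ha hv.2.1
    exact (D.cov_split (D.chart1 hd hc hc1 hfin 13 (Or.inl le_rfl)) h2 h3).mono
      (by norm_num) subset_rfl

/-- The polar cubic cannot vanish identically. -/
theorem _root_.Dat.cubic_ne [IsAlgClosed K] [CharP K 2] (D : Dat K) (hd : D.d1 = 0)
    (hc : D.c ≠ 0) (hc1 : D.c1 = 0) (h30 : D.a30 = 0) (h21 : D.a21 = 0) (h12 : D.a12 = 0)
    (h03 : D.a03 = 0) {m : ℕ} (hfin : Cov K m D.S) : False := by
  obtain ⟨r, hr⟩ := exists_sqrt_fun (K := K)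
  let k2 : K := D.e11 * D.q3 - D.c * D.e0
  let k1 : K[X] := (C D.b31 + C D.b13 * X ^ 2) * C D.q3
    + C D.e11 * (C D.q1 + C D.q2 * X ^ 2 + C D.c * X)
    - C D.c * (C D.e20 + C D.e11 * X + C D.e02 * X ^ 2)
  let k0 : K[X] := (C D.b31 + C D.b13 * X ^ 2) * (C D.q1 + C D.q2 * X ^ 2 + C D.c * X)
    - C D.c * (C D.b40 + C D.b31 * X + C D.b22 * X ^ 2 + C D.b13 * X ^ 3 + C D.b04 * X ^ 4)
  have hk1 : ∀ u, k1.eval u = (D.b31 + D.b13 * u ^ 2) * D.q3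
    + D.e11 * (D.q1 + D.q2 * u ^ 2 + D.c * u)
    - D.c * (D.e20 + D.e11 * u + D.e02 * u ^ 2) := by
    intro u; simp only [k1, eval_sub, eval_mul, eval_add, eval_C, eval_X, eval_pow]
  have hk0 : ∀ u, k0.eval u = (D.b31 + D.b13 * u ^ 2) * (D.q1 + D.q2 * u ^ 2 + D.c * u)
    - D.c * (D.b40 + D.b31 * u + D.b22 * u ^ 2 + D.b13 * u ^ 3 + D.b04 * u ^ 4) := by
    intro u; simp only [k0, eval_sub, eval_mul, eval_add, eval_C, eval_X, eval_pow]
  have key : ∀ u t, k2 * t ^ 4 + k1.eval u * t ^ 2 + k0.eval u = 0 →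
      ((1, u, t, r (-(D.b31 + D.b13 * u ^ 2 + t ^ 2 * D.e11) / D.c)) : K × K × K × K) ∈ D.S := by
    intro u t h
    have hw : -(D.b31 + D.b13 * u ^ 2 + t ^ 2 * D.e11) / D.c * D.c =
      -(D.b31 + D.b13 * u ^ 2 + t ^ 2 * D.e11) := div_mul_cancel₀ _ hc
    rw [hk1, hk0] at h
    simp only [k2] at h
    rw [D.S_iff1 _ _ _ hd, hr, hc1, h30, h21, h12, h03]
    refine ⟨by rw [hw]; ring, by ring, ?_⟩
    apply mul_left_cancel₀ hc
    linear_combination (D.q1 + D.q2 * u ^ 2 + D.c * u + D.q3 * t ^ 2) * hw - h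
  by_cases hk2 : k2 = 0
  · by_cases hk : k1 = 0
    · by_cases hκ : D.b13 * D.q2 - D.c * D.b04 = 0
      · have hco : D.b13 * D.q3 + D.e11 * D.q2 - D.c * D.e02 = 0 := by
          have : k1.coeff 2 = 0 := by rw [hk]; simp
          simp only [k1] at this
          simpa [coeff_X, coeff_C] using this
        refine hfin.false (fun t => (0, 1, t, r (-(D.b13 + t ^ 2 * D.e11) / D.c)))
          (inj2 0 1 (Or.inr rfl) _) ?_
        convert Set.infinite_univ (α := K)
        ext t
        simp only [Set.mem_ofPred_eq, Set.mem_univ, iff_true]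
        have hw : -(D.b13 + t ^ 2 * D.e11) / D.c * D.c =
          -(D.b13 + t ^ 2 * D.e11) := div_mul_cancel₀ _ hc
        rw [D.S_iff2 _ _ hd, hr, hc1, h12]
        refine ⟨by rw [hw]; ring, h03, ?_⟩
        apply mul_left_cancel₀ hc
        simp only [k2] at hk2
        linear_combination (D.q2 + D.q3 * t ^ 2) * hw - hκ - t ^ 2 * hco - t ^ 4 * hk2
      · have hdeg : k0.degree ≠ 0 := by
          intro h
          have h4 : k0.coeff 4 = 0 := by
            apply coeff_eq_zero_of_degree_lt; rw [h]; norm_num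
          apply hκ
          have h5 : k0 = C (D.b31 * D.q1 - D.c * D.b40) + C (D.b31 * D.c - D.c * D.b31) * X
            + C (D.b31 * D.q2 + D.b13 * D.q1 - D.c * D.b22) * X ^ 2
            + C (D.b13 * D.c - D.c * D.b13) * X ^ 3
            + C (D.b13 * D.q2 - D.c * D.b04) * X ^ 4 := by
            simp only [k0, map_sub, map_mul, map_add]; ring
          rw [h5] at h4
          simp only [coeff_add, coeff_C_mul, coeff_X_pow, coeff_C, coeff_X] at h4
          simpa using h4
        obtain ⟨u, hu⟩ := IsAlgClosed.exists_root k0 hdeg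
        refine hfin.false
          (fun t => (1, u, t, r (-(D.b31 + D.b13 * u ^ 2 + t ^ 2 * D.e11) / D.c)))
          (inj2 1 u (Or.inl rfl) _) ?_
        convert Set.infinite_univ (α := K)
        ext t
        simp only [Set.mem_ofPred_eq, Set.mem_univ, iff_true]
        apply key
        rw [hk2, hk, hu]; simp
    · refine hfin.false
        (fun u => (1, u, r (-k0.eval u / k1.eval u), r (-(D.b31 + D.b13 * u ^ 2 +
          r (-k0.eval u / k1.eval u) ^ 2 * D.e11) / D.c)))
          (inj1 _) ?_
      refine (infinite_nonroots hk).mono ?_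
      intro u hu
      simp only [Set.mem_ofPred_eq] at hu ⊢
      apply key
      rw [hr, hk2]
      field_simp
      ring
  · have : ∀ u, ∃ t, k2 * t ^ 4 + k1.eval u * t ^ 2 + k0.eval u = 0 := by
      intro u
      obtain ⟨t, ht⟩ := IsAlgClosed.exists_root
        (C k2 * X ^ 4 + C (k1.eval u) * X ^ 2 + C (k0.eval u)) (by
          have : (C k2 * X ^ 4 + C (k1.eval u) * X ^ 2 + C (k0.eval u)).degree = 4 := by
            compute_degree!
          rw [this]; norm_num)
      refine ⟨t, ?_⟩
      simpa using ht
    choose τ hτ using this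
    refine hfin.false
        (fun u => (1, u, τ u, r (-(D.b31 + D.b13 * u ^ 2 + τ u ^ 2 * D.e11) / D.c)))
          (inj1 _) ?_
    convert Set.infinite_univ (α := K)
    ext u
    simp only [Set.mem_ofPred_eq, Set.mem_univ, iff_true]
    exact key _ _ (hτ u)

/-- Counting over the first chart, when the polar cubic is a union of lines. -/
theorem _root_.Dat.chart1_lines (D : Dat K) [CharP K 2] (hd : D.d1 = 0) (hc1 : D.c1 = 0) (k : ℕ)
    (g : K[X]) (hg : g = C D.a30 + C D.a21 * X + C D.a12 * X ^ 2 + C D.a03 * X ^ 3)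
    (hg0 : g ≠ 0) (n : ℕ) (hn : g.natDegree ≤ n)
    (h : ∀ u, D.a30 + D.a21 * u + D.a12 * u ^ 2 + D.a03 * u ^ 3 = 0 →
      Cov K k {v | ∃ t z : K, v = (1, u, t, z) ∧ v ∈ D.S}) :
    Cov K (n * k) {v | ∃ u t z : K, v = (1, u, t, z) ∧ v ∈ D.S} := by
  classical
  have hge : ∀ u, g.eval u = D.a30 + D.a21 * u + D.a12 * u ^ 2 + D.a03 * u ^ 3 := by
    intro u; rw [hg]; simp only [eval_mul, eval_add, eval_C, eval_X, eval_pow]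
  refine (Cov.biUnion (n := n) g.roots.toFinset ((Multiset.toFinset_card_le _).trans
        ((Polynomial.card_roots' g).trans hn))
      (fun u => {v | ∃ t z : K, v = (1, u, t, z) ∧ v ∈ D.S}) (m := k) ?_).mono le_rfl ?_
  · intro u hu
    apply h
    rw [← hge]
    simpa [hg0] using hu
  · rintro _ ⟨u, t, z, rfl, hv⟩
    refine ⟨u, ?_, t, z, rfl, hv⟩
    rw [D.S_iff1 _ _ _ hd] at hv
    have : g.eval u = 0 := by
      rw [hge]; linear_combination hv.2.1 - t ^ 2 * hc1
    simpa [hg0] using this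

theorem _root_.Dat.case_lines [IsAlgClosed K] [CharP K 2] (D : Dat K) (hd : D.d1 = 0)
    (hc : D.c ≠ 0) (hc1 : D.c1 = 0) {m : ℕ} (hfin : Cov K m D.S) : Cov K 16 D.S := by
  have h3 := D.chart3 hd hc1 hfin
  let g : K[X] := C D.a30 + C D.a21 * X + C D.a12 * X ^ 2 + C D.a03 * X ^ 3
  have hg0 : g ≠ 0 := by
    intro h
    have e0 : g.coeff 0 = 0 := by rw [h]; simp
    have e1 : g.coeff 1 = 0 := by rw [h]; simp
    have e2 : g.coeff 2 = 0 := by rw [h]; simp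
    have e3 : g.coeff 3 = 0 := by rw [h]; simp
    simp [g, coeff_X, coeff_C] at e0 e1 e2 e3
    exact D.cubic_ne hd hc hc1 e0 e1 e2 e3 hfin
  have hf := fun u hu => D.chart1_fibre hd hc hc1 hfin u hu
  by_cases ha : D.a03 = 0
  · have hdeg : g.natDegree ≤ 2 := by
      simp only [g, ha, map_zero, zero_mul, add_zero]; compute_degree
    exact (D.cov_split (D.chart1_lines hd hc1 4 g rfl hg0 2 hdeg hf)
      (D.chart2 hd hc hfin 4 (Or.inr ⟨hc1, le_rfl⟩) ha) h3).mono (by norm_num) subset_rfl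
  · have h2 : Cov K 0 {v | ∃ t z : K, v = (0, 1, t, z) ∧ v ∈ D.S} := by
      refine cov_empty _ _ ?_
      rintro _ ⟨t, z, rfl, hv⟩
      rw [D.S_iff2 _ _ hd] at hv
      exact ha hv.2.1
    have hdeg : g.natDegree ≤ 3 := by
      simp only [g]; compute_degree
    exact (D.cov_split (D.chart1_lines hd hc1 4 g rfl hg0 3 hdeg hf) h2 h3).mono
      (by norm_num) subset_rfl

/-- The case where `Q` is the square of a linear form. -/
theorem _root_.Dat.case_square [IsAlgClosed K] [CharP K 2] (D : Dat K) (hd : D.d1 = 0)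
    (hc : D.c = 0) (hc1 : D.c1 = 0) (z0 : K) (hz0 : z0 ^ 2 * D.q3 + D.e0 = 0)
    {m : ℕ} (hfin : Cov K m D.S) : Cov K 16 D.S := by
  obtain ⟨r, hr⟩ := exists_sqrt_fun (K := K)
  have h3 := D.chart3 hd hc1 hfin
  have hq3 : D.q3 ≠ 0 := by
    intro h
    have he : D.e0 = 0 := by linear_combination hz0 - z0 ^ 2 * h
    refine hfin.false (fun z => (0, 0, 1, z)) (inj3 0 0 1 (by simp)) ?_
    convert Set.infinite_univ (α := K)
    ext z
    simp [D.S_iff3 _ hd, hc1, he, h]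
  have hQ1 : ∀ u t z, ((1, u, t, z) : K × K × K × K) ∈ D.S →
      D.q1 + D.q2 * u ^ 2 + D.q3 * t ^ 2 ≠ 0 := by
    intro u t z hv h
    refine hfin.false (fun z => (1, u, t, z)) (inj3 1 u t (by simp)) ?_
    convert Set.infinite_univ (α := K)
    ext z'
    simp only [Set.mem_ofPred_eq, Set.mem_univ, iff_true]
    rw [D.S_iff1 _ _ _ hd, hc] at hv ⊢
    obtain ⟨e1, e2, e3⟩ := hv
    exact ⟨by linear_combination e1, e2, by linear_combination e3 + (z' ^ 2 - z ^ 2) * h⟩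
  have hQ2 : ∀ t z, ((0, 1, t, z) : K × K × K × K) ∈ D.S → D.q2 + D.q3 * t ^ 2 ≠ 0 := by
    intro t z hv h
    refine hfin.false (fun z => (0, 1, t, z)) (inj3 0 1 t (by simp)) ?_
    convert Set.infinite_univ (α := K)
    ext z'
    simp only [Set.mem_ofPred_eq, Set.mem_univ, iff_true]
    rw [D.S_iff2 _ _ hd, hc] at hv ⊢
    obtain ⟨e1, e2, e3⟩ := hv
    exact ⟨by linear_combination e1, e2, by linear_combination e3 + (z' ^ 2 - z ^ 2) * h⟩
  -- explicit points
  let f1 : K → K → K := fun u t => r (-(D.b40 + D.b31 * u + D.b22 * u ^ 2 + D.b13 * u ^ 3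
      + D.b04 * u ^ 4 + t ^ 2 * (D.e20 + D.e11 * u + D.e02 * u ^ 2) + D.e0 * t ^ 4) /
      (D.q1 + D.q2 * u ^ 2 + D.q3 * t ^ 2))
  let f2 : K → K := fun t => r (-(D.b04 + t ^ 2 * D.e02 + D.e0 * t ^ 4) / (D.q2 + D.q3 * t ^ 2))
  have k1 : ∀ u t, D.q1 + D.q2 * u ^ 2 + D.q3 * t ^ 2 ≠ 0 →
      D.b31 + D.b13 * u ^ 2 + t * (D.a21 + D.a03 * u ^ 2) + t ^ 2 * D.e11 = 0 →
      D.a30 + D.a21 * u + D.a12 * u ^ 2 + D.a03 * u ^ 3 = 0 →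
      ((1, u, t, f1 u t) : K × K × K × K) ∈ D.S := by
    intro u t hQ e1 e2
    rw [D.S_iff1 _ _ _ hd, hc, hc1]
    simp only [f1]
    rw [hr]
    refine ⟨by linear_combination e1, by linear_combination e2, ?_⟩
    have := div_mul_cancel₀ (-(D.b40 + D.b31 * u + D.b22 * u ^ 2 + D.b13 * u ^ 3
      + D.b04 * u ^ 4 + t ^ 2 * (D.e20 + D.e11 * u + D.e02 * u ^ 2) + D.e0 * t ^ 4)) hQ
    linear_combination this
  have k1' : ∀ u t z, ((1, u, t, z) : K × K × K × K) ∈ D.S → z = f1 u t := by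
    intro u t z hv
    have hQ := hQ1 _ _ _ hv
    rw [D.S_iff1 _ _ _ hd, hc, hc1] at hv
    apply char_two_sq_inj
    simp only [f1]
    rw [hr, eq_div_iff hQ]
    linear_combination hv.2.2
  have k2 : ∀ t, D.q2 + D.q3 * t ^ 2 ≠ 0 →
      D.b13 + t * D.a12 + t ^ 2 * D.e11 = 0 → D.a03 = 0 →
      ((0, 1, t, f2 t) : K × K × K × K) ∈ D.S := by
    intro t hQ e1 e2
    rw [D.S_iff2 _ _ hd, hc, hc1]
    simp only [f2]
    rw [hr]
    refine ⟨by linear_combination e1, by linear_combination e2, ?_⟩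
    have := div_mul_cancel₀ (-(D.b04 + t ^ 2 * D.e02 + D.e0 * t ^ 4)) hQ
    linear_combination this
  have k2' : ∀ t z, ((0, 1, t, z) : K × K × K × K) ∈ D.S → z = f2 t := by
    intro t z hv
    have hQ := hQ2 _ _ hv
    rw [D.S_iff2 _ _ hd, hc, hc1] at hv
    apply char_two_sq_inj
    simp only [f2]
    rw [hr, eq_div_iff hQ]
    linear_combination hv.2.2
  have hinf : ∀ a : K, {t : K | a + D.q3 * t ^ 2 ≠ 0}.Infinite := by
    intro a
    have hne : (C a + C D.q3 * X ^ 2 : K[X]) ≠ 0 := by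
      intro h
      have : (C a + C D.q3 * X ^ 2 : K[X]).coeff 2 = 0 := by rw [h]; simp
      simp at this
      exact hq3 this
    simpa using infinite_nonroots hne
  -- the fibre over `(0 : 1)`
  have h2 : Cov K 2 {v | ∃ t z : K, v = (0, 1, t, z) ∧ v ∈ D.S} := by
    by_cases ha : D.a03 = 0
    · let p : K[X] := C D.b13 + X * C D.a12 + X ^ 2 * C D.e11
      have hp : ∀ t, p.eval t = D.b13 + t * D.a12 + t ^ 2 * D.e11 := by
        intro u; simp only [p, eval_mul, eval_add, eval_C, eval_X, eval_pow]
      refine hfin.poly (fun t => (0, 1, t, f2 t)) p (by simp only [p]; compute_degree)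
        (inj2 0 1 (Or.inr rfl) _) ?_ _ ?_
      · intro h0
        refine (hinf D.q2).mono ?_
        intro t ht
        refine k2 t ht ?_ ha
        rw [← hp, h0]; simp
      · rintro _ ⟨t, z, rfl, hv⟩
        refine ⟨t, 1, ?_, ?_⟩
        · rw [D.S_iff2 _ _ hd, hc, hc1] at hv
          rw [hp]; linear_combination hv.1
        · simp [k2' _ _ hv]
    · refine cov_empty _ _ ?_
      rintro _ ⟨t, z, rfl, hv⟩
      rw [D.S_iff2 _ _ hd] at hv
      exact ha hv.2.1
  have hf : ∀ u, D.a30 + D.a21 * u + D.a12 * u ^ 2 + D.a03 * u ^ 3 = 0 →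
      Cov K 2 {v | ∃ t z : K, v = (1, u, t, z) ∧ v ∈ D.S} := by
    intro u hu
    let p : K[X] := C (D.b31 + D.b13 * u ^ 2) + X * C (D.a21 + D.a03 * u ^ 2) + X ^ 2 * C D.e11
    have hp : ∀ t, p.eval t = D.b31 + D.b13 * u ^ 2 + t * (D.a21 + D.a03 * u ^ 2)
        + t ^ 2 * D.e11 := by
      intro u; simp only [p, eval_mul, eval_add, eval_C, eval_X, eval_pow]
    refine hfin.poly (fun t => (1, u, t, f1 u t)) p (by simp only [p]; compute_degree)
      (inj2 1 u (Or.inl rfl) _) ?_ _ ?_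
    · intro h0
      refine (hinf (D.q1 + D.q2 * u ^ 2)).mono ?_
      intro t ht
      refine k1 u t ht ?_ hu
      rw [← hp, h0]; simp
    · rintro _ ⟨t, z, rfl, hv⟩
      refine ⟨t, 1, ?_, ?_⟩
      · rw [D.S_iff1 _ _ _ hd, hc, hc1] at hv
        rw [hp]; linear_combination hv.1
      · simp [k1' _ _ _ hv]
  let g : K[X] := C D.a30 + C D.a21 * X + C D.a12 * X ^ 2 + C D.a03 * X ^ 3
  by_cases hg0 : g = 0
  · have a0 : g.coeff 0 = 0 := by rw [hg0]; simp
    have a1 : g.coeff 1 = 0 := by rw [hg0]; simp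
    have a2 : g.coeff 2 = 0 := by rw [hg0]; simp
    have a3 : g.coeff 3 = 0 := by rw [hg0]; simp
    simp [g, coeff_X, coeff_C] at a0 a1 a2 a3
    by_cases he : D.e11 = 0
    · exfalso
      by_cases hb : D.b13 = 0
      · refine hfin.false (fun t => (0, 1, t, f2 t)) (inj2 0 1 (Or.inr rfl) _) ?_
        refine (hinf D.q2).mono ?_
        intro t ht
        refine k2 t ht ?_ a3
        simp [hb, a2, he]
      · have hu := hr (-D.b31 / D.b13)
        set u := r (-D.b31 / D.b13)
        refine hfin.false (fun t => (1, u, t, f1 u t)) (inj2 1 u (Or.inl rfl) _) ?_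
        refine (hinf (D.q1 + D.q2 * u ^ 2)).mono ?_
        intro t ht
        refine k1 u t ht ?_ ?_
        · rw [hu, a1, a3, he]; field_simp; ring
        · simp [a0, a1, a2, a3]
    · let p : K[X] := C D.q1 + C D.q2 * X ^ 2 + C D.q3 * (C D.e11⁻¹ *
        (- C D.b31 - C D.b13 * X ^ 2))
      have hpe : ∀ u, p.eval u = D.q1 + D.q2 * u ^ 2 + D.q3 * (D.e11⁻¹ *
        (- D.b31 - D.b13 * u ^ 2)) := by
        intro u
        simp only [p, eval_mul, eval_add, eval_sub, eval_neg, eval_C, eval_X, eval_pow]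
      by_cases hp : p = 0
      · have h1 : Cov K 0 {v | ∃ u t z : K, v = (1, u, t, z) ∧ v ∈ D.S} := by
          refine cov_empty _ _ ?_
          rintro _ ⟨u, t, z, rfl, hv⟩
          refine hQ1 _ _ _ hv ?_
          rw [D.S_iff1 _ _ _ hd, hc, hc1, a1, a3] at hv
          have : t ^ 2 = D.e11⁻¹ * (- D.b31 - D.b13 * u ^ 2) := by
            field_simp
            linear_combination hv.1
          rw [this, ← hpe, hp]; simp
        exact (D.cov_split h1 h2 h3).mono (by norm_num) subset_rfl
      · exfalso
        refine hfin.false (fun u => (1, u, r (D.e11⁻¹ * (- D.b31 - D.b13 * u ^ 2)),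
          f1 u (r (D.e11⁻¹ * (- D.b31 - D.b13 * u ^ 2)))))
          (inj1 (fun u => (r (D.e11⁻¹ * (- D.b31 - D.b13 * u ^ 2)),
          f1 u (r (D.e11⁻¹ * (- D.b31 - D.b13 * u ^ 2)))))) ?_
        refine (infinite_nonroots hp).mono ?_
        intro u hu
        refine k1 _ _ ?_ ?_ ?_
        · rw [hr, ← hpe]; exact hu
        · rw [hr, a1, a3]; field_simp; ring
        · simp [a0, a1, a2, a3]
  · have hdeg : g.natDegree ≤ 3 := by
      simp only [g]; compute_degree
    exact (D.cov_split (D.chart1_lines hd hc1 2 g rfl hg0 3 hdeg hf) h2 h3).mono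
      (by norm_num) subset_rfl

end Polynomial
section Forms

variable {K : Type*} [Field K]

/-- The affine cone over the singular locus of `z² Q + B`. -/
def SQ (Q B : MvPolynomial (Fin 3) K) : Set ((Fin 3 → K) × K) :=
  {v | v.2 ^ 2 * eval v.1 Q + eval v.1 B = 0 ∧
    ∀ i, v.2 ^ 2 * eval v.1 (pderiv i Q) + eval v.1 (pderiv i B) = 0}

theorem form_expand (n : ℕ) (hn : n = 2 ∨ n = 4) (p : MvPolynomial (Fin 3) K)
    (hp : p.IsHomogeneous n) : ∃ c : ℕ → ℕ → K, p = ∑ i ∈ Finset.range (n + 1),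
      ∑ j ∈ Finset.range (n + 1 - i), C (c i j) * X 0 ^ i * X 1 ^ j * X 2 ^ (n - i - j) := by
  classical
  rw [p.as_sum]
  refine Finset.sum_induction _ (fun q : MvPolynomial (Fin 3) K => ∃ c : ℕ → ℕ → K,
    q = ∑ i ∈ Finset.range (n + 1),
      ∑ j ∈ Finset.range (n + 1 - i), C (c i j) * X 0 ^ i * X 1 ^ j * X 2 ^ (n - i - j)) ?_ ?_ ?_
  · rintro _ _ ⟨c, rfl⟩ ⟨c', rfl⟩
    refine ⟨fun i j => c i j + c' i j, ?_⟩
    simp only [← Finset.sum_add_distrib]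
    refine Finset.sum_congr rfl fun i _ => Finset.sum_congr rfl fun j _ => ?_
    rw [map_add]; ring
  · exact ⟨fun _ _ => 0, by simp⟩
  · intro d hd
    have hdeg : d 0 + d 1 + d 2 = n := by
      have := hp (mem_support_iff.1 hd)
      rw [Finsupp.weight_apply, Finsupp.sum_fintype _ _ (by simp)] at this
      simpa [Fin.sum_univ_three] using this
    refine ⟨fun i j => if i = d 0 ∧ j = d 1 then p.coeff d else 0, ?_⟩
    have hm : monomial d (p.coeff d) = C (p.coeff d) * X 0 ^ d 0 * X 1 ^ d 1 * X 2 ^ d 2 := by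
      rw [monomial_eq, Finsupp.prod_fintype _ _ (by simp), Fin.prod_univ_three]; ring
    rw [hm, Finset.sum_eq_single (d 0), Finset.sum_eq_single (d 1)]
    · simp only [and_self, if_true]
      congr 2
      omega
    · intro j _ hj; simp [hj]
    · intro h; simp at h; omega
    · intro i _ hi; simp [hi]
    · intro h; simp at h; omega

theorem normal_form [CharP K 2] (Q B : MvPolynomial (Fin 3) K)
    (hQ : Q.IsHomogeneous 2) (hB : B.IsHomogeneous 4)
    (h0 : eval ![0, 0, 1] (pderiv 0 Q) = 0) (h1 : eval ![0, 0, 1] (pderiv 1 Q) = 0)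
    (hb : eval ![0, 0, 1] (pderiv 1 B) = 0) :
    ∃ D : Dat K, D.d1 = 0 ∧
      (∀ x y t z, ((![x, y, t], z) : (Fin 3 → K) × K) ∈ SQ Q B ↔ (x, y, t, z) ∈ D.S) ∧
      (D.c = eval ![0, 1, 0] (pderiv 0 Q)) ∧
      (D.c = 0 → ∀ v i, eval v (pderiv i Q) = 0) := by
  have h2 : (2 : K) = 0 := CharTwo.two_eq_zero
  obtain ⟨q, hq⟩ := form_expand 2 (Or.inl rfl) Q hQ
  obtain ⟨b, hb'⟩ := form_expand 4 (Or.inr rfl) B hB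
  simp only [Finset.sum_range_succ, Finset.sum_range_zero, zero_add, Nat.reduceAdd, Nat.reduceSub,
    pow_zero, mul_one, pow_one] at hq hb'
  have eQ : ∀ v : Fin 3 → K, eval v Q = q 0 0 * v 2 ^ 2 + q 0 1 * v 1 * v 2 + q 0 2 * v 1 ^ 2
      + (q 1 0 * v 0 * v 2 + q 1 1 * v 0 * v 1) + q 2 0 * v 0 ^ 2 := by
    intro v; rw [hq]; simp
  have eQ0 : ∀ v : Fin 3 → K, eval v (pderiv 0 Q) = q 1 0 * v 2 + q 1 1 * v 1 := by
    intro v; rw [hq]; simp [pderiv_X, Pi.single_apply]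
    linear_combination q 2 0 * v 0 * h2
  have eQ1 : ∀ v : Fin 3 → K, eval v (pderiv 1 Q) = q 0 1 * v 2 + q 1 1 * v 0 := by
    intro v; rw [hq]; simp [pderiv_X, Pi.single_apply]
    linear_combination q 0 2 * v 1 * h2
  have eQ2 : ∀ v : Fin 3 → K, eval v (pderiv 2 Q) = q 0 1 * v 1 + q 1 0 * v 0 := by
    intro v; rw [hq]; simp [pderiv_X, Pi.single_apply]
    exact Or.inr (Or.inl h2)
  have eB : ∀ v : Fin 3 → K, eval v B = b 0 0 * v 2 ^ 4 + b 0 1 * v 1 * v 2 ^ 3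
      + b 0 2 * v 1 ^ 2 * v 2 ^ 2 + b 0 3 * v 1 ^ 3 * v 2 + b 0 4 * v 1 ^ 4
      + b 1 0 * v 0 * v 2 ^ 3 + b 1 1 * v 0 * v 1 * v 2 ^ 2 + b 1 2 * v 0 * v 1 ^ 2 * v 2
      + b 1 3 * v 0 * v 1 ^ 3 + b 2 0 * v 0 ^ 2 * v 2 ^ 2 + b 2 1 * v 0 ^ 2 * v 1 * v 2
      + b 2 2 * v 0 ^ 2 * v 1 ^ 2 + b 3 0 * v 0 ^ 3 * v 2 + b 3 1 * v 0 ^ 3 * v 1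
      + b 4 0 * v 0 ^ 4 := by
    intro v; rw [hb']; simp; ring
  have eB0 : ∀ v : Fin 3 → K, eval v (pderiv 0 B) = 
      b 1 0 * v 2 ^ 3 + b 1 1 * v 1 * v 2 ^ 2 + b 1 2 * v 1 ^ 2 * v 2
      + b 1 3 * v 1 ^ 3 + b 3 0 * v 0 ^ 2 * v 2 + b 3 1 * v 0 ^ 2 * v 1 := by
    intro v; rw [hb']; simp [pderiv_X, Pi.single_apply]
    linear_combination (b 2 0 * v 0 * v 2 ^ 2 + b 2 1 * v 0 * v 1 * v 2
      + b 2 2 * v 0 * v 1 ^ 2 + b 3 0 * v 0 ^ 2 * v 2 + b 3 1 * v 0 ^ 2 * v 1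
      + 2 * b 4 0 * v 0 ^ 3) * h2
  have eB1 : ∀ v : Fin 3 → K, eval v (pderiv 1 B) = 
      b 0 1 * v 2 ^ 3 + b 0 3 * v 1 ^ 2 * v 2
      + b 1 1 * v 0 * v 2 ^ 2
      + b 1 3 * v 0 * v 1 ^ 2 + b 2 1 * v 0 ^ 2 * v 2 + b 3 1 * v 0 ^ 3 := by
    intro v; rw [hb']; simp [pderiv_X, Pi.single_apply]
    linear_combination (b 0 2 * v 1 * v 2 ^ 2 + b 0 3 * v 1 ^ 2 * v 2 + 2 * b 0 4 * v 1 ^ 3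
      + b 1 2 * v 0 * v 1 * v 2 + b 1 3 * v 0 * v 1 ^ 2
      + b 2 2 * v 0 ^ 2 * v 1) * h2
  have eB2 : ∀ v : Fin 3 → K, eval v (pderiv 2 B) = 
      b 0 1 * v 1 * v 2 ^ 2 + b 0 3 * v 1 ^ 3
      + b 1 0 * v 0 * v 2 ^ 2 + b 1 2 * v 0 * v 1 ^ 2
      + b 2 1 * v 0 ^ 2 * v 1 + b 3 0 * v 0 ^ 3 := by
    intro v; rw [hb']; simp [pderiv_X, Pi.single_apply]
    linear_combination (2 * b 0 0 * v 2 ^ 3 + b 0 1 * v 1 * v 2 ^ 2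
      + b 0 2 * v 1 ^ 2 * v 2 
      + b 1 0 * v 0 * v 2 ^ 2 + b 1 1 * v 0 * v 1 * v 2 
      + b 2 0 * v 0 ^ 2 * v 2) * h2
  have q10 : q 1 0 = 0 := by simpa [eQ0] using h0
  have q01 : q 0 1 = 0 := by simpa [eQ1] using h1
  have b01 : b 0 1 = 0 := by simpa [eB1] using hb
  refine ⟨{ c := q 1 1, q1 := q 2 0, q2 := q 0 2, q3 := q 0 0, b40 := b 4 0, b31 := b 3 1,
            b22 := b 2 2, b13 := b 1 3, b04 := b 0 4, a30 := b 3 0, a21 := b 2 1, a12 := b 1 2,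
            a03 := b 0 3, e20 := b 2 0, e11 := b 1 1, e02 := b 0 2, c1 := b 1 0, d1 := b 0 1,
            e0 := b 0 0 }, b01, ?_, ?_, ?_⟩
  · intro x y t z
    simp only [SQ, Set.mem_ofPred_eq, eQ, eB, Fin.forall_fin_succ, Fin.isValue]
    constructor
    · rintro ⟨e, e0, e1, e2, -⟩
      have f0 := eQ0 ![x, y, t]
      have f1 := eQ1 ![x, y, t]
      have f2 := eQ2 ![x, y, t]
      have g0 := eB0 ![x, y, t]
      have g1 := eB1 ![x, y, t]
      have g2 := eB2 ![x, y, t]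
      simp at e e0 e1 e2 f0 f1 f2 g0 g1 g2
      rw [f0, g0] at e0
      rw [f1, g1] at e1
      rw [f2, g2] at e2
      rw [q10, q01] at *
      refine ⟨x, y, t, z, rfl, ?_, ?_, ?_, ?_⟩
      · linear_combination e0
      · linear_combination e1
      · linear_combination e2
      · linear_combination e - t * e2
    · rintro ⟨_, _, _, _, he, e0, e1, e2, e⟩
      simp only [Prod.mk.injEq] at he
      obtain ⟨rfl, rfl, rfl, rfl⟩ := he
      have f0 := eQ0 ![x, y, t]
      have f1 := eQ1 ![x, y, t]
      have f2 := eQ2 ![x, y, t]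
      have g0 := eB0 ![x, y, t]
      have g1 := eB1 ![x, y, t]
      have g2 := eB2 ![x, y, t]
      simp at e e0 e1 e2 f0 f1 f2 g0 g1 g2
      simp
      rw [f0, f1, f2, g0, g1, g2, q10, q01]
      refine ⟨?_, ?_, ?_, ?_⟩
      · linear_combination e + t * e2
      · linear_combination e0
      · linear_combination e1
      · linear_combination e2
  · simp [eQ0]
  · intro hc v i
    simp only at hc
    fin_cases i
    · simp [eQ0, hc, q10]
    · simp [eQ1, hc, q01]
    · simp [eQ2, q10, q01]

/-- The strange point of a conic in characteristic two. -/
theorem strange_point [CharP K 2] (Q : MvPolynomial (Fin 3) K)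
    (hQ : Q.IsHomogeneous 2) (hne : ¬ ∀ v i, eval v (pderiv i Q) = 0) :
    ∃ p : Fin 3 → K, p ≠ 0 ∧ ∀ i, eval p (pderiv i Q) = 0 := by
  have h2 : (2 : K) = 0 := CharTwo.two_eq_zero
  obtain ⟨q, hq⟩ := form_expand 2 (Or.inl rfl) Q hQ
  simp only [Finset.sum_range_succ, Finset.sum_range_zero, zero_add, Nat.reduceAdd, Nat.reduceSub,
    pow_zero, mul_one, pow_one] at hq
  have eQ0 : ∀ v : Fin 3 → K, eval v (pderiv 0 Q) = q 1 0 * v 2 + q 1 1 * v 1 := by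
    intro v; rw [hq]; simp [pderiv_X, Pi.single_apply]
    linear_combination q 2 0 * v 0 * h2
  have eQ1 : ∀ v : Fin 3 → K, eval v (pderiv 1 Q) = q 0 1 * v 2 + q 1 1 * v 0 := by
    intro v; rw [hq]; simp [pderiv_X, Pi.single_apply]
    linear_combination q 0 2 * v 1 * h2
  have eQ2 : ∀ v : Fin 3 → K, eval v (pderiv 2 Q) = q 0 1 * v 1 + q 1 0 * v 0 := by
    intro v; rw [hq]; simp [pderiv_X, Pi.single_apply]
    exact Or.inr (Or.inl h2)
  refine ⟨![q 0 1, q 1 0, q 1 1], ?_, ?_⟩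
  · intro h
    apply hne
    have a0 := congrFun h 0
    have a1 := congrFun h 1
    have a2 := congrFun h 2
    simp at a0 a1 a2
    intro v i
    fin_cases i
    · simp [eQ0, a1, a2]
    · simp [eQ1, a0, a2]
    · simp [eQ2, a0, a1]
  · intro i
    fin_cases i
    · simp [eQ0]; linear_combination q 1 0 * q 1 1 * h2
    · simp [eQ1]; linear_combination q 0 1 * q 1 1 * h2
    · simp [eQ2]; linear_combination q 0 1 * q 1 0 * h2

end Forms
section Change

variable {K : Type*} [Field K]

/-- Linear substitution. -/
def lsub (A : (Fin 3 → K) ≃ₗ[K] (Fin 3 → K)) (p : MvPolynomial (Fin 3) K) :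
    MvPolynomial (Fin 3) K :=
  aeval (fun j => ∑ i, C (A (Pi.single i 1) j) * X i : Fin 3 → MvPolynomial (Fin 3) K) p

theorem equiv_coord (A : (Fin 3 → K) ≃ₗ[K] (Fin 3 → K)) (x : Fin 3 → K) (j : Fin 3) :
    A x j = ∑ i, A (Pi.single i 1) j * x i := by
  conv_lhs => rw [pi_eq_sum_univ' x]
  simp [mul_comm, Pi.single_apply, eq_comm]

theorem lsub_hom (A : (Fin 3 → K) ≃ₗ[K] (Fin 3 → K)) {n : ℕ} {p : MvPolynomial (Fin 3) K}
    (hp : p.IsHomogeneous n) : (lsub A p).IsHomogeneous n := by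
  have := hp.aeval (n := 1)
    (fun j => ∑ i, C (A (Pi.single i 1) j) * X i : Fin 3 → MvPolynomial (Fin 3) K)
    (fun j => IsHomogeneous.sum _ _ _ fun i _ => (isHomogeneous_X _ _).C_mul _)
  rw [one_mul] at this
  exact this

theorem eval_lsub (A : (Fin 3 → K) ≃ₗ[K] (Fin 3 → K)) (p : MvPolynomial (Fin 3) K)
    (x : Fin 3 → K) : eval x (lsub A p) = eval (A x) p := by
  unfold lsub
  induction p using MvPolynomial.induction_on with
  | C a => simp
  | add p q hp hq => rw [map_add, map_add, map_add, hp, hq]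
  | mul_X p j h => rw [map_mul, map_mul, h, map_mul]; congr 1; simp [equiv_coord A x j]

theorem eval_pderiv_lsub (A : (Fin 3 → K) ≃ₗ[K] (Fin 3 → K)) (p : MvPolynomial (Fin 3) K)
    (x : Fin 3 → K) (i : Fin 3) : eval x (pderiv i (lsub A p)) =
      ∑ j, eval (A x) (pderiv j p) * A (Pi.single i 1) j := by
  induction p using MvPolynomial.induction_on with
  | C a => simp [lsub]
  | add p q hp hq =>
    simp only [lsub, map_add] at *
    rw [hp, hq, ← Finset.sum_add_distrib]
    exact Finset.sum_congr rfl fun _ _ => by ring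
  | mul_X p k h =>
    have h1 : lsub A (p * X k) = lsub A p * ∑ i, C (A (Pi.single i 1) k) * X i := by
      simp [lsub]
    have h2 : eval x (∑ i, C (A (Pi.single i 1) k) * X i) = A x k := by
      simp [equiv_coord A x k]
    have h3 : eval x (pderiv i (∑ i, C (A (Pi.single i 1) k) * X i : MvPolynomial (Fin 3) K))
        = A (Pi.single i 1) k := by
      simp [pderiv_X, Pi.single_apply]
    rw [h1, pderiv_mul, map_add, map_mul, map_mul, h, h2, h3, eval_lsub]
    simp only [pderiv_mul, map_add, map_mul, eval_X, pderiv_X]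
    simp only [add_mul, Finset.sum_add_distrib, Finset.sum_mul]
    congr 1
    · exact Finset.sum_congr rfl fun _ _ => by ring
    · rw [Finset.sum_eq_single k]
      · simp
      · intro b _ hb
        simp [Pi.single_apply, hb.symm]
      · simp

theorem functional_zero (A : (Fin 3 → K) ≃ₗ[K] (Fin 3 → K)) (g : Fin 3 → K)
    (h : ∀ i, ∑ j, g j * A (Pi.single i 1) j = 0) : ∀ j, g j = 0 := by
  intro j
  have h1 : ∀ x, ∑ j, g j * A x j = 0 := by
    intro x
    have : ∑ j, g j * A x j = ∑ i, x i * ∑ j, g j * A (Pi.single i 1) j := by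
      simp only [equiv_coord A x, Finset.mul_sum]
      rw [Finset.sum_comm]
      exact Finset.sum_congr rfl fun _ _ => Finset.sum_congr rfl fun _ _ => by ring
    rw [this]
    simp [h]
  have := h1 (A.symm (Pi.single j 1))
  simpa [Pi.single_apply] using this

theorem grads_lsub (A : (Fin 3 → K) ≃ₗ[K] (Fin 3 → K)) (p : MvPolynomial (Fin 3) K)
    (h : ∀ v i, eval v (pderiv i (lsub A p)) = 0) : ∀ v i, eval v (pderiv i p) = 0 := by
  intro v
  apply functional_zero A
  intro i
  have := h (A.symm v) i
  rwa [eval_pderiv_lsub, LinearEquiv.apply_symm_apply] at this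

theorem SQ_lsub (A : (Fin 3 → K) ≃ₗ[K] (Fin 3 → K)) (Q B : MvPolynomial (Fin 3) K)
    (x : Fin 3 → K) (z : K) : (x, z) ∈ SQ (lsub A Q) (lsub A B) ↔ (A x, z) ∈ SQ Q B := by
  have key : ∀ i, z ^ 2 * eval x (pderiv i (lsub A Q)) + eval x (pderiv i (lsub A B)) =
      ∑ j, (z ^ 2 * eval (A x) (pderiv j Q) + eval (A x) (pderiv j B)) * A (Pi.single i 1) j := by
    intro i
    rw [eval_pderiv_lsub, eval_pderiv_lsub, Finset.mul_sum, ← Finset.sum_add_distrib]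
    exact Finset.sum_congr rfl fun _ _ => by ring
  constructor
  · rintro ⟨h1, h2⟩
    refine ⟨by simpa [eval_lsub] using h1, ?_⟩
    apply functional_zero A
    intro i
    rw [← key]
    exact h2 i
  · rintro ⟨h1, h2⟩
    refine ⟨by simpa [eval_lsub] using h1, ?_⟩
    intro i
    have h3 := key i
    simp only at h2 ⊢
    rw [h3]
    simp [h2]

theorem exists_change (p : Fin 3 → K) (hp : p ≠ 0) (g : Fin 3 → K)
    (hg : ∑ j, g j * p j = 0) : ∃ A : (Fin 3 → K) ≃ₗ[K] (Fin 3 → K),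
      A ![0, 0, 1] = p ∧ ∑ j, g j * A (Pi.single 1 1) j = 0 := by
  let φ : (Fin 3 → K) →ₗ[K] K := ∑ j, g j • LinearMap.proj j
  have hφ : ∀ x, φ x = ∑ j, g j * x j := by intro x; simp [φ]
  have hk : 1 < Module.finrank K (LinearMap.ker φ) := by
    have h1 := LinearMap.finrank_range_add_finrank_ker φ
    have h2 : Module.finrank K (LinearMap.range φ) ≤ Module.finrank K K :=
      Submodule.finrank_le _
    simp at h1 h2
    omega
  let p' : LinearMap.ker φ := ⟨p, by rw [LinearMap.mem_ker, hφ]; exact hg⟩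
  have hp' : p' ≠ 0 := fun h => hp (congrArg Subtype.val h)
  obtain ⟨y, hy⟩ := exists_linearIndependent_pair_of_one_lt_finrank hk hp'
  have hy2 : LinearIndependent K ![(y : Fin 3 → K), p] := by
    have h1 := hy.map' (LinearMap.ker φ).subtype (Submodule.ker_subtype _)
    have h2 := (LinearIndependent.pair_symm_iff (R := K) (x := p) (y := (y : Fin 3 → K))).1
    apply h2
    convert h1 using 1
    ext i : 1
    fin_cases i <;> rfl
  obtain ⟨x, hx⟩ := exists_linearIndependent_cons_of_lt_finrank hy2 (by simp)
  let b := basisOfLinearIndependentOfCardEqFinrank hx (by simp)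
  have hb : ∀ i, b i = (Fin.cons x ![(y : Fin 3 → K), p] : Fin 3 → Fin 3 → K) i := by
    intro i; simp [b]
  refine ⟨(Pi.basisFun K (Fin 3)).equiv b (Equiv.refl _), ?_, ?_⟩
  · have : (![0, 0, 1] : Fin 3 → K) = Pi.basisFun K (Fin 3) 2 := by
      ext i; fin_cases i <;> simp
    rw [this, Module.Basis.equiv_apply]
    simp [hb]
  · have : (Pi.single 1 1 : Fin 3 → K) = Pi.basisFun K (Fin 3) 1 := by simp
    rw [this, Module.Basis.equiv_apply]
    have h3 : b ((Equiv.refl _) 1) = (y : Fin 3 → K) := by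
      rw [hb]; rfl
    rw [h3, ← hφ]
    exact y.2

theorem transfer (A : (Fin 3 → K) ≃ₗ[K] (Fin 3 → K)) (Q B : MvPolynomial (Fin 3) K) (D : Dat K)
    (hD : ∀ x y t z, (![x, y, t], z) ∈ SQ (lsub A Q) (lsub A B) ↔ (x, y, t, z) ∈ D.S)
    (h : ∀ m, Cov K m D.S → Cov K 16 D.S) {m : ℕ} (hm : Cov K m (SQ Q B)) :
    Cov K 16 (SQ Q B) := by
  have h1 : Cov K m D.S := by
    refine hm.map
      { toFun := fun w => (A.symm w.1 0, A.symm w.1 1, A.symm w.1 2, w.2)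
        map_add' := by intro a b; simp
        map_smul' := by intro a b; simp } ?_
    rintro ⟨x, y, t, z⟩ hw
    refine ⟨(A ![x, y, t], z), (SQ_lsub A Q B _ _).1 ((hD x y t z).2 hw), ?_⟩
    simp
  refine (h m h1).map
    { toFun := fun w => (A ![w.1, w.2.1, w.2.2.1], w.2.2.2)
      map_add' := by
        intro a b
        refine Prod.ext ?_ rfl
        simp only [Prod.fst_add, ← map_add]
        congr 1
        ext i; fin_cases i <;> simp
      map_smul' := by
        intro a b
        refine Prod.ext ?_ rfl
        simp only [Prod.smul_fst, RingHom.id_apply, ← map_smul]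
        congr 1
        ext i; fin_cases i <;> simp } ?_
  rintro ⟨v, z⟩ hv
  have e : (![A.symm v 0, A.symm v 1, A.symm v 2] : Fin 3 → K) = A.symm v := by
    ext i; fin_cases i <;> simp
  refine ⟨(A.symm v 0, A.symm v 1, A.symm v 2, z), ?_, ?_⟩
  · rw [← hD, SQ_lsub, e, LinearEquiv.apply_symm_apply]
    exact hv
  · simp [e]

theorem core [IsAlgClosed K] [CharP K 2] (Q B : MvPolynomial (Fin 3) K)
    (hQ : Q.IsHomogeneous 2) (hB : B.IsHomogeneous 4) {m : ℕ} (hm : Cov K m (SQ Q B)) :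
    Cov K 16 (SQ Q B) := by
  have two : (2 : K) = 0 := CharP.cast_eq_zero K 2
  by_cases hgr : ∀ v i, eval v (pderiv i Q) = 0
  · by_cases hall : ∀ w ∈ SQ Q B, w.1 = 0
    · refine ⟨{(0, 1)}, by simp, ?_⟩
      rintro ⟨v, z⟩ hv
      refine ⟨(0, 1), by simp, z, ?_⟩
      have := hall _ hv
      simp only at this
      simp [this]
    push Not at hall
    obtain ⟨⟨p, z0⟩, hp, hp0⟩ := hall
    have hgB : ∀ j, eval p (pderiv j B) = 0 := by
      intro j
      have := hp.2 j
      simpa [hgr] using this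
    obtain ⟨A, hA, -⟩ := exists_change p hp0 (fun j => eval p (pderiv j B)) (by simp [hgB])
    have hgr' : ∀ v i, eval v (pderiv i (lsub A Q)) = 0 := by
      intro v i; rw [eval_pderiv_lsub]; simp [hgr]
    obtain ⟨D, hd, hD, hc, -⟩ := normal_form (lsub A Q) (lsub A B) (lsub_hom A hQ) (lsub_hom A hB)
      (hgr' _ _) (hgr' _ _) (by rw [eval_pderiv_lsub, hA]; simp [hgB])
    rw [hgr'] at hc
    have hz : (0, 0, 1, z0) ∈ D.S := by
      rw [← hD, SQ_lsub, hA]; exact hp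
    rw [D.S_iff3 z0 hd] at hz
    exact transfer A Q B D hD (fun m h => D.case_square hd hc hz.1 z0 hz.2 h) hm
  · obtain ⟨p, hp0, hp⟩ := strange_point Q hQ hgr
    have heul : ∑ j, eval p (pderiv j B) * p j = 0 := by
      have := congrArg (eval p) hB.sum_X_mul_pderiv
      simp only [map_sum, map_mul, eval_X, nsmul_eq_mul] at this
      have h4 : (eval p) ((4 : ℕ) : MvPolynomial (Fin 3) K) = 0 := by
        rw [map_natCast]
        push_cast
        linear_combination 2 * two
      rw [h4, zero_mul] at this
      rw [← this]
      exact Finset.sum_congr rfl fun _ _ => by ring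
    obtain ⟨A, hA, hA1⟩ := exists_change p hp0 (fun j => eval p (pderiv j B)) heul
    obtain ⟨D, hd, hD, -, hc⟩ := normal_form (lsub A Q) (lsub A B) (lsub_hom A hQ) (lsub_hom A hB)
      (by rw [eval_pderiv_lsub, hA]; simp [hp]) (by rw [eval_pderiv_lsub, hA]; simp [hp])
      (by rw [eval_pderiv_lsub, hA]; exact hA1)
    have hc0 : D.c ≠ 0 := fun h => hgr (grads_lsub A Q (hc h))
    refine transfer A Q B D hD (fun m h => ?_) hm
    by_cases h1 : D.c1 = 0
    · exact D.case_lines hd hc0 h1 h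
    · exact D.case_generic hd hc0 h1 h

end Change

section Final

variable {K : Type*} [Field K]

theorem hom_eval_smul {σ : Type*} {n : ℕ} {p : MvPolynomial σ K} (hp : p.IsHomogeneous n)
    (k : K) (v : σ → K) : eval (k • v) p = k ^ n * eval v p := by
  rw [eval_eq, eval_eq, Finset.mul_sum]
  refine Finset.sum_congr rfl fun d hd => ?_
  have hdeg : ∑ i ∈ d.support, d i = n := by
    have := hp (mem_support_iff.1 hd)
    rw [Finsupp.weight_apply] at this
    simpa [Finsupp.sum] using this
  simp only [Pi.smul_apply, smul_eq_mul, mul_pow, Finset.prod_mul_distrib, Finset.prod_pow_eq_pow_sum,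
    hdeg]
  ring

/-- The affine cone over the singular locus. -/
def coneF (F : MvPolynomial (Fin 4) K) : Set (Fin 4 → K) :=
  {v | eval v F = 0 ∧ ∀ i, eval v (pderiv i F) = 0}

theorem coneF_smul {F : MvPolynomial (Fin 4) K} {n : ℕ} (hF : F.IsHomogeneous n) (k : K)
    {v : Fin 4 → K} (hv : v ∈ coneF F) : k • v ∈ coneF F := by
  refine ⟨?_, fun i => ?_⟩
  · rw [hom_eval_smul hF, hv.1, mul_zero]
  · rw [hom_eval_smul hF.pderiv, hv.2 i, mul_zero]

theorem cov_of_finite {F : MvPolynomial (Fin 4) K} {n : ℕ} (hF : F.IsHomogeneous n)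
    (hfin : (singLocus F).Finite) : ∃ m, Cov K m (coneF F) := by
  classical
  refine ⟨_, insert 0 (hfin.toFinset.image Projectivization.rep), le_rfl, ?_⟩
  intro v hv
  by_cases h0 : v = 0
  · exact ⟨0, Finset.mem_insert_self _ _, 0, by simp [h0]⟩
  have hmem : Projectivization.mk K v h0 ∈ singLocus F := by
    intro w hw hwv
    obtain ⟨a, ha⟩ := (Projectivization.mk_eq_mk_iff' K w v hw h0).1 hwv
    rw [← ha]
    exact coneF_smul hF a hv
  obtain ⟨a, ha⟩ := Projectivization.exists_smul_eq_mk_rep K v h0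
  refine ⟨(Projectivization.mk K v h0).rep, Finset.mem_insert_of_mem
    (Finset.mem_image_of_mem _ (hfin.mem_toFinset.2 hmem)), (a⁻¹ : Kˣ), ?_⟩
  rw [← ha]
  change v = a⁻¹ • a • v
  rw [inv_smul_smul]

theorem ncard_of_cov {F : MvPolynomial (Fin 4) K} {n : ℕ} (h : Cov K n (coneF F)) :
    (singLocus F).ncard ≤ n := by
  classical
  obtain ⟨L, hL, h⟩ := h
  let f : (Fin 4 → K) → Projectivization K (Fin 4 → K) := fun q =>
    if hq : q ≠ 0 then Projectivization.mk K q hq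
    else Projectivization.mk K (Pi.single 0 1) (by simp)
  have hsub : singLocus F ⊆ (L.image f : Set _) := by
    intro p hp
    have h1 := hp p.rep p.rep_nonzero p.mk_rep
    obtain ⟨q, hq, k, hk⟩ := h p.rep h1
    have hq0 : q ≠ 0 := by
      rintro rfl
      exact p.rep_nonzero (by rw [hk, smul_zero])
    rw [Finset.coe_image]
    refine ⟨q, hq, ?_⟩
    have : f q = Projectivization.mk K q hq0 := by simp [f, hq0]
    rw [this, ← p.mk_rep]
    refine ((Projectivization.mk_eq_mk_iff' K _ _ _ _).2 ⟨k, hk.symm⟩).symm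
  calc (singLocus F).ncard ≤ (L.image f : Set _).ncard :=
        Set.ncard_le_ncard hsub (Finset.finite_toSet _)
    _ = (L.image f).card := Set.ncard_coe_finset _
    _ ≤ L.card := Finset.card_image_le
    _ ≤ n := hL

theorem coneF_iff [CharP K 2] (Q B : MvPolynomial (Fin 3) K) (c : Fin 3 → Fin 4)
    (hc : Function.Injective c) (hc3 : ∀ i, c i ≠ 3) (hcs : ∀ j, j ≠ 3 → ∃ i, c i = j)
    (v : Fin 4 → K) :
    v ∈ coneF (X 3 ^ 2 * rename c Q + rename c B) ↔ (v ∘ c, v 3) ∈ SQ Q B := by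
  have two : (2 : K) = 0 := CharP.cast_eq_zero K 2
  have hz : ∀ p : MvPolynomial (Fin 3) K, pderiv 3 (rename c p) = 0 := by
    intro p
    apply pderiv_eq_zero_of_notMem_vars
    classical
    intro h
    obtain ⟨i, -, hi⟩ := Finset.mem_image.1 (vars_rename c p h)
    exact hc3 i hi
  have h3 : eval v (pderiv 3 (X 3 ^ 2 * rename c Q + rename c B)) = 0 := by
    rw [map_add, pderiv_mul, hz, hz, pderiv_pow]
    simp [two]
  have hi : ∀ i, eval v (pderiv (c i) (X 3 ^ 2 * rename c Q + rename c B)) =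
      v 3 ^ 2 * eval (v ∘ c) (pderiv i Q) + eval (v ∘ c) (pderiv i B) := by
    intro i
    rw [map_add, pderiv_mul, pderiv_rename hc, pderiv_rename hc, pderiv_pow,
      pderiv_X_of_ne (hc3 i).symm]
    simp [eval_rename]
  have h0 : eval v (X 3 ^ 2 * rename c Q + rename c B) =
      v 3 ^ 2 * eval (v ∘ c) Q + eval (v ∘ c) B := by
    simp [eval_rename]
  constructor
  · rintro ⟨h1, h2⟩
    refine ⟨by rw [← h1, h0], fun i => ?_⟩
    rw [← h2 (c i), hi]
  · rintro ⟨h1, h2⟩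
    refine ⟨by rw [h0]; exact h1, fun j => ?_⟩
    by_cases hj : j = 3
    · rw [hj]; exact h3
    · obtain ⟨i, rfl⟩ := hcs j hj
      rw [hi]; exact h2 i

theorem cone_to_SQ [CharP K 2] (Q B : MvPolynomial (Fin 3) K) (c : Fin 3 → Fin 4)
    (hc : Function.Injective c) (hc3 : ∀ i, c i ≠ 3) (hcs : ∀ j, j ≠ 3 → ∃ i, c i = j)
    {m : ℕ} (h : Cov K m (coneF (X 3 ^ 2 * rename c Q + rename c B))) : Cov K m (SQ Q B) := by
  refine h.map ((LinearMap.funLeft K K c).prod (LinearMap.proj 3)) ?_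
  rintro ⟨x, z⟩ hx
  let v : Fin 4 → K := fun j => if h : j = 3 then z else x ((hcs j h).choose)
  have hv1 : v ∘ c = x := by
    funext i
    have : v (c i) = x ((hcs (c i) (hc3 i)).choose) := by simp [v, hc3 i]
    rw [Function.comp_apply, this, hc (hcs (c i) (hc3 i)).choose_spec]
  have hv2 : v 3 = z := by simp [v]
  refine ⟨v, ?_, ?_⟩
  · rw [coneF_iff Q B c hc hc3 hcs, hv1, hv2]; exact hx
  · exact Prod.ext hv1 hv2

theorem SQ_to_cone [CharP K 2] (Q B : MvPolynomial (Fin 3) K) (c : Fin 3 → Fin 4)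
    (hc : Function.Injective c) (hc3 : ∀ i, c i ≠ 3) (hcs : ∀ j, j ≠ 3 → ∃ i, c i = j)
    {m : ℕ} (h : Cov K m (SQ Q B)) : Cov K m (coneF (X 3 ^ 2 * rename c Q + rename c B)) := by
  have hch : ∀ j : Fin 4, ∃ g : ((Fin 3 → K) × K) →ₗ[K] K, ∀ v : Fin 4 → K,
      g (v ∘ c, v 3) = v j := by
    intro j
    by_cases hj : j = 3
    · exact ⟨LinearMap.snd K _ _, fun v => by simp [hj]⟩
    · obtain ⟨i, rfl⟩ := hcs j hj
      exact ⟨(LinearMap.proj i).comp (LinearMap.fst K _ _), fun v => by simp⟩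
  choose g hg using hch
  refine h.map (LinearMap.pi g) ?_
  intro v hv
  refine ⟨(v ∘ c, v 3), (coneF_iff Q B c hc hc3 hcs v).1 hv, ?_⟩
  funext j
  exact hg j v

end Final

/-- Let `K` be algebraically closed of characteristic 2 and `X = {F = 0} ⊆ ℙ³_K` an irreducible
quartic with finite singular locus, with a double point at `P = [0:0:0:1]` such that
`F = z²·Q(x) + B(x)` (inseparable projection from `P`: the cubic term `G` vanishes).  Then
`|Sing(X)| ≤ 16`. -/
theorem inseparable_projection_singular_count_le_sixteen
    {K : Type*} [Field K] [IsAlgClosed K] [CharP K 2]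
    (Q B : MvPolynomial (Fin 3) K)
    (hQhom : Q.IsHomogeneous 2) (hQ0 : Q ≠ 0) (hBhom : B.IsHomogeneous 4)
    (F : MvPolynomial (Fin 4) K)
    (hF : F = X 3 ^ 2 * rename (Fin.castLE (by norm_num : (3:ℕ) ≤ 4)) Q
        + rename (Fin.castLE (by norm_num : (3:ℕ) ≤ 4)) B)
    (hFirr : Irreducible F) (hfin : (singLocus F).Finite) :
    (singLocus F).ncard ≤ 16 := by
  have hc : Function.Injective (Fin.castLE (by norm_num : (3:ℕ) ≤ 4)) := Fin.castLE_injective _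
  have hc3 : ∀ i, Fin.castLE (by norm_num : (3:ℕ) ≤ 4) i ≠ 3 := by decide
  have hcs : ∀ j : Fin 4, j ≠ 3 → ∃ i, Fin.castLE (by norm_num : (3:ℕ) ≤ 4) i = j := by decide
  have hFhom : F.IsHomogeneous 4 := by
    rw [hF]
    exact ((isHomogeneous_X_pow 3 2).mul hQhom.rename_isHomogeneous).add
      hBhom.rename_isHomogeneous
  obtain ⟨m, hm⟩ := cov_of_finite hFhom hfin
  apply ncard_of_cov
  subst hF
  exact SQ_to_cone Q B _ hc hc3 hcs
    (core Q B hQhom hBhom (cone_to_SQ Q B _ hc hc3 hcs hm))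

end
end
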